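/- arXiv:2104.12638 — 13 statements merged into one kernel-verified Lean document; each statement's English description precedes it below -/
import Mathlib

section
/- The identity B1/(B1 − 1) = q holds, and q > 1. -/
/-- The identity B1/(B1 − 1) = q holds, and q > 1. -/
theorem stmt_2 (r μ σ la c L : ℝ)
    (hr : 0 < r) (hμ : r < μ) (hσ : 0 < σ) (hla : 0 < la) (hc : 0 < c) (hL : 0 < L)
    (δ B1 q : ℝ)
    (hδ : δ = (1/2) * ((μ - r)/σ)^2)
    (hB1 : B1 = (1/(2*δ)) * ((r - la + δ) + Real.sqrt ((r - la + δ)^2 + 4*δ*la)))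
    (hq : q = (1/(2*r)) * ((r + la + δ) + Real.sqrt ((r + la + δ)^2 - 4*r*la))) :
    B1 / (B1 - 1) = q ∧ 1 < q := by
  have hδ0 : 0 < δ := by
    have : 0 < (μ - r) / σ := div_pos (sub_pos.mpr hμ) hσ
    rw [hδ]
    positivity
  have hdisc : (r + la + δ)^2 - 4*r*la = (r - la + δ)^2 + 4*δ*la := by ring
  rw [hdisc] at hq
  have hS := Real.sq_sqrt (show 0 ≤ (r - la + δ)^2 + 4*δ*la by positivity)
  have hS0 := Real.sqrt_nonneg ((r - la + δ)^2 + 4*δ*la)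
  set S := Real.sqrt ((r - la + δ)^2 + 4*δ*la)
  have habs : |r - la - δ| < S := by
    refine abs_lt_of_sq_lt_sq ?_ hS0
    nlinarith [mul_pos hr hδ0]
  obtain ⟨hlower, hupper⟩ := abs_lt.mp habs
  have hB1' : B1 - 1 = (r - la - δ + S) / (2*δ) := by
    rw [hB1]
    field_simp
    ring
  have hq' : q - 1 = (la + δ - r + S) / (2*r) := by
    rw [hq]
    field_simp
    ring
  have hB1pos : 0 < B1 - 1 := by
    rw [hB1']
    exact div_pos (by linarith) (by positivity)
  have hqpos : 0 < q - 1 := by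
    rw [hq']
    exact div_pos (by linarith) (by positivity)
  have hprod : (B1 - 1) * (q - 1) = 1 := by
    rw [hB1', hq', div_mul_div_comm, div_eq_one_iff_eq (by positivity)]
    linear_combination hS
  refine ⟨?_, by linarith⟩
  rw [div_eq_iff hB1pos.ne']
  linear_combination -hprod
end

section
/- The strict inequality r·(q − 1) > δ holds. -/
/-- The strict inequality r·(q − 1) > δ holds. -/
theorem stmt_3 (r μ σ la c L : ℝ)
    (hr : 0 < r) (hμ : r < μ) (hσ : 0 < σ) (hla : 0 < la) (hc : 0 < c) (hL : 0 < L)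
    (δ q : ℝ)
    (hδ : δ = (1/2) * ((μ - r)/σ)^2)
    (hq : q = (1/(2*r)) * ((r + la + δ) + Real.sqrt ((r + la + δ)^2 - 4*r*la))) :
    r * (q - 1) > δ := by
  have hδ0 : 0 < δ := by
    rw [hδ]
    have : 0 < (μ - r) / σ := div_pos (sub_pos.mpr hμ) hσ
    positivity
  have hsqrt : r + δ - la < Real.sqrt ((r + la + δ)^2 - 4*r*la) := by
    apply Real.lt_sqrt_of_sq_lt
    nlinarith [mul_pos hla hδ0]
  have hrq : r * q = ((r + la + δ) + Real.sqrt ((r + la + δ)^2 - 4*r*la)) / 2 := by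
    rw [hq]
    field_simp
  linarith
end

section
/- The function g is strictly increasing on the open interval (0, 1), g(z) tends to −∞ as z tends to 0 from the right, and g(1) = L > 0; consequently, g has exactly one zero in the open interval (0, 1). -/
open Filter Topology Set in
/-- A difference of a positive and a negative real power with positive coefficients is strictly
increasing on the positive half-line. -/
lemma strictMonoOn_rpow_add_rpow {a d p q : ℝ} (ha : 0 < a) (hd : d < 0) (hp : 0 < p)
    (hq : q < 0) : StrictMonoOn (fun z : ℝ => a * z ^ p + d * z ^ q) (Ioi 0) := by
  intro x hx y _ hxy
  have h1 := mul_lt_mul_of_pos_left (Real.rpow_lt_rpow (le_of_lt hx) hxy hp) ha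
  have h2 := mul_lt_mul_of_neg_left (Real.rpow_lt_rpow_of_neg hx hxy hq) hd
  exact add_lt_add h1 h2

open Filter Topology Set in
lemma tendsto_rpow_add_rpow_atBot {a d p q : ℝ} (hd : d < 0) (hp : 0 < p) (hq : q < 0) :
    Tendsto (fun z : ℝ => a * z ^ p + d * z ^ q) (𝓝[>] 0) atBot := by
  have h1 : Tendsto (fun z : ℝ => a * z ^ p) (𝓝[>] 0) (𝓝 (a * 0 ^ p)) :=
    (((Real.continuousAt_rpow_const 0 p (Or.inr hp.le)).tendsto).mono_left
      nhdsWithin_le_nhds).const_mul a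
  exact h1.add_atBot ((tendsto_rpow_neg_nhdsGT_zero hq).const_mul_atTop_of_neg hd)

/-- The roots of `δ x ^ 2 - (r - k + δ) x - k` lie on either side of `[0, 1]`. -/
lemma one_lt_root_and_root_neg {δ r k : ℝ} (hδ : 0 < δ) (hr : 0 < r) (hk : 0 < k) :
    1 < (1 / (2 * δ)) * ((r - k + δ) + √((r - k + δ) ^ 2 + 4 * δ * k)) ∧
      (1 / (2 * δ)) * ((r - k + δ) - √((r - k + δ) ^ 2 + 4 * δ * k)) < 0 := by
  have h1 : 2 * δ - (r - k + δ) < √((r - k + δ) ^ 2 + 4 * δ * k) :=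
    Real.lt_sqrt_of_sq_lt (by nlinarith [mul_pos hδ hr])
  have h2 : r - k + δ < √((r - k + δ) ^ 2 + 4 * δ * k) :=
    Real.lt_sqrt_of_sq_lt (by nlinarith [mul_pos hδ hk])
  constructor
  · rw [one_div_mul_eq_div, lt_div_iff₀ (by positivity)]
    linarith
  · exact mul_neg_of_pos_of_neg (by positivity) (by linarith)


/-- g is strictly increasing on (0,1), tends to −∞ as z → 0⁺, g(1) = L > 0;
consequently g has exactly one zero in (0,1). -/
theorem stmt_4 (r μ σ la ρ c L : ℝ)
    (hr : 0 < r) (hμ : r < μ) (hσ : 0 < σ) (hla : 0 < la) (hρ : 0 < ρ)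
    (hc : 0 < c) (hL : 0 < L)
    (δ B3 B4 : ℝ)
    (hδ : δ = (1/2) * ((μ - r)/σ)^2)
    (hB3 : B3 = (1/(2*δ)) * ((r - la - ρ + δ) + Real.sqrt ((r - la - ρ + δ)^2 + 4*δ*(la + ρ))))
    (hB4 : B4 = (1/(2*δ)) * ((r - la - ρ + δ) - Real.sqrt ((r - la - ρ + δ)^2 + 4*δ*(la + ρ))))
    (g : ℝ → ℝ)
    (hg : ∀ z > 0, g z =
      (c/r + L) * ((B3*(1 - B4)/(B3 - B4)) * z ^ (B3 - 1)
        + (B4*(B3 - 1)/(B3 - B4)) * z ^ (B4 - 1)) - c/r) :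
    StrictMonoOn g (Set.Ioo 0 1) ∧
      Filter.Tendsto g (nhdsWithin 0 (Set.Ioi 0)) Filter.atBot ∧
      g 1 = L ∧ 0 < L ∧
      (∃! z : ℝ, z ∈ Set.Ioo (0:ℝ) 1 ∧ g z = 0) := by
  have hδ0 : 0 < δ := by
    have := div_pos (sub_pos.2 hμ) hσ
    rw [hδ]; positivity
  obtain ⟨h3, h4⟩ : 1 < B3 ∧ B4 < 0 := by
    have h := one_lt_root_and_root_neg hδ0 hr (add_pos hla hρ)
    rw [← sub_sub] at h
    rwa [hB3, hB4]
  clear hB3 hB4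
  have hd : 0 < B3 - B4 := by linarith
  have hK : 0 < c / r + L := by positivity
  have ha : 0 < B3 * (1 - B4) / (B3 - B4) :=
    div_pos (mul_pos (by linarith) (by linarith)) hd
  have hb : B4 * (B3 - 1) / (B3 - B4) < 0 :=
    div_neg_of_neg_of_pos (mul_neg_of_neg_of_pos h4 (by linarith)) hd
  have hp : 0 < B3 - 1 := by linarith
  have hq : B4 - 1 < 0 := by linarith
  have hmono : StrictMonoOn g (Set.Ioi 0) := by
    intro x hx y hy hxy
    rw [hg x hx, hg y hy]
    exact sub_lt_sub_right
      (mul_lt_mul_of_pos_left (strictMonoOn_rpow_add_rpow ha hb hp hq hx hy hxy) hK) _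
  have hlim : Filter.Tendsto g (nhdsWithin 0 (Set.Ioi 0)) Filter.atBot := by
    refine Filter.Tendsto.congr' (Filter.eventuallyEq_of_mem self_mem_nhdsWithin
      fun z hz => (hg z hz).symm) ?_
    exact Filter.tendsto_atBot_add_const_right _ (-(c / r))
      ((tendsto_rpow_add_rpow_atBot hb hp hq).const_mul_atBot hK)
  have hone : g 1 = L := by
    rw [hg 1 one_pos, Real.one_rpow, Real.one_rpow]
    field_simp
    ring
  have hcont : ContinuousOn g (Set.Ioi 0) := by
    refine ContinuousOn.congr ?_ hg
    have h (s : ℝ) : ContinuousOn (fun z : ℝ => z ^ s) (Set.Ioi 0) := fun z hz =>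
      (Real.continuousAt_rpow_const z s (Or.inl (ne_of_gt hz))).continuousWithinAt
    exact (continuousOn_const.mul ((continuousOn_const.mul (h _)).add
      (continuousOn_const.mul (h _)))).sub continuousOn_const
  refine ⟨hmono.mono Set.Ioo_subset_Ioi_self, hlim, hone, hL, ?_⟩
  obtain ⟨a, hga, ha0, ha1⟩ := ((hlim.eventually_lt_atBot 0).and
    (Ioo_mem_nhdsGT (zero_lt_one' ℝ))).exists
  obtain ⟨z, hz, hgz⟩ := intermediate_value_Ioo ha1.le
    (hcont.mono fun x hx => lt_of_lt_of_le ha0 hx.1) ⟨hga, hone.symm ▸ hL⟩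
  refine ⟨z, ⟨⟨ha0.trans hz.1, hz.2⟩, hgz⟩, fun y hy => ?_⟩
  exact hmono.injOn hy.1.1 (ha0.trans hz.1) (hy.2.trans hgz.symm)
end

section
/- Let y0 > 0 and yL > 0 with y0 < yL. (a) The function ĥ1(y) = (c/r)·(y − (y0/B1)·(y/y0)^{B1}) has, at every y ∈ (0, y0), second derivative equal to −(c/r)·((B1−1)/y0)·(y/y0)^{B1−2}, which is strictly negative. (b) The function ĥ2(y) = ρ/(λ+ρ) − (c/r + L)·yL·[ ((1−B4)/(B3−B4))·(y/yL)^{B3} + ((B3−1)/(B3−B4))·(y/yL)^{B4} ] + (c/r)·y has, at every y ∈ (y0, yL), second derivative equal to −(c/r + L)·(1/yL)·((B3−1)·(1−B4)/(B3−B4))·[ B3·(y/yL)^{B3−2} − B4·(y/yL)^{B4−2} ], which is strictly negative. In particular, ĥ1 is strictly concave on (0, y0) and ĥ2 is strictly concave on (y0, yL). -/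
/-- The larger root of `δ x² - (r - m + δ) x - m` exceeds `1` when `δ` and `r` are positive. -/
theorem one_lt_larger_root {δ r m : ℝ} (hδ : 0 < δ) (hr : 0 < r) :
    1 < (1/(2*δ)) * ((r - m + δ) + Real.sqrt ((r - m + δ)^2 + 4*δ*m)) := by
  have hsqrt : 2*δ - (r - m + δ) < Real.sqrt ((r - m + δ)^2 + 4*δ*m) := by
    apply Real.lt_sqrt_of_sq_lt
    nlinarith [mul_pos hδ hr]
  rw [one_div_mul_eq_div, lt_div_iff₀ (by positivity)]
  linarith

/-- The smaller root of `δ x² - k x - m` is negative when `δ` and `m` are positive. -/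
theorem smaller_root_neg {δ k m : ℝ} (hδ : 0 < δ) (hm : 0 < m) :
    (1/(2*δ)) * (k - Real.sqrt (k^2 + 4*δ*m)) < 0 := by
  have hsqrt : k < Real.sqrt (k^2 + 4*δ*m) := by
    apply Real.lt_sqrt_of_sq_lt
    nlinarith [mul_pos hδ hm]
  exact mul_neg_of_pos_of_neg (by positivity) (by linarith)

theorem hasDerivAt_div_rpow {a y : ℝ} (b : ℝ) (ha : 0 < a) (hy : 0 < y) :
    HasDerivAt (fun x : ℝ => (x/a) ^ b) (b / a * (y/a) ^ (b - 1)) y := by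
  convert ((hasDerivAt_id' y).div_const a).rpow_const (p := b)
    (Or.inl (div_pos hy ha).ne') using 1
  ring

/-- The first derivative of an affine function plus two scaled powers. -/
theorem hasDerivAt_affine_add_rpow {a y : ℝ} (A k p q α β : ℝ) (ha : 0 < a) (hy : 0 < y) :
    HasDerivAt (fun x : ℝ => A + k * x + p * (x/a) ^ α + q * (x/a) ^ β)
      (k + p * (α / a * (y/a) ^ (α - 1)) + q * (β / a * (y/a) ^ (β - 1))) y := by
  refine (((((hasDerivAt_id' y).const_mul k).const_add A).add
    ((hasDerivAt_div_rpow α ha hy).const_mul p)).add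
    ((hasDerivAt_div_rpow β ha hy).const_mul q)).congr_deriv ?_
  ring

/-- The second derivative of an affine function plus two scaled powers. -/
theorem deriv_deriv_affine_add_rpow {a y : ℝ} (A k p q α β : ℝ) (ha : 0 < a) (hy : 0 < y) :
    deriv (deriv fun x : ℝ => A + k * x + p * (x/a) ^ α + q * (x/a) ^ β) y =
      p * α * (α - 1) / a^2 * (y/a) ^ (α - 2) + q * β * (β - 1) / a^2 * (y/a) ^ (β - 2) := by
  have hev : (deriv fun x : ℝ => A + k * x + p * (x/a) ^ α + q * (x/a) ^ β) =ᶠ[nhds y]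
      fun x => k + p * (α / a * (x/a) ^ (α - 1)) + q * (β / a * (x/a) ^ (β - 1)) := by
    filter_upwards [lt_mem_nhds hy] with x hx
    exact (hasDerivAt_affine_add_rpow A k p q α β ha hx).deriv
  rw [hev.deriv_eq]
  have hα := ((hasDerivAt_div_rpow (α - 1) ha hy).const_mul (α / a)).const_mul p
  have hβ := ((hasDerivAt_div_rpow (β - 1) ha hy).const_mul (β / a)).const_mul q
  refine ((hα.const_add k).add hβ).deriv.trans ?_
  rw [show α - 1 - 1 = α - 2 by ring, show β - 1 - 1 = β - 2 by ring]
  ring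

theorem continuousOn_affine_add_rpow {a : ℝ} (A k p q α β : ℝ) (ha : 0 < a) :
    ContinuousOn (fun x : ℝ => A + k * x + p * (x/a) ^ α + q * (x/a) ^ β) (Set.Ioi 0) :=
  fun _ hy => (hasDerivAt_affine_add_rpow A k p q α β ha hy).continuousAt.continuousWithinAt

/-- Second derivatives and strict concavity of the two pieces of the dual function ψ̂. -/
theorem stmt_5 (r μ σ la ρ c L : ℝ)
    (hr : 0 < r) (hμ : r < μ) (hσ : 0 < σ) (hla : 0 < la) (hρ : 0 < ρ)
    (hc : 0 < c) (hL : 0 < L)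
    (δ B1 B3 B4 : ℝ)
    (hδ : δ = (1/2) * ((μ - r)/σ)^2)
    (hB1 : B1 = (1/(2*δ)) * ((r - la + δ) + Real.sqrt ((r - la + δ)^2 + 4*δ*la)))
    (hB3 : B3 = (1/(2*δ)) * ((r - la - ρ + δ) + Real.sqrt ((r - la - ρ + δ)^2 + 4*δ*(la + ρ))))
    (hB4 : B4 = (1/(2*δ)) * ((r - la - ρ + δ) - Real.sqrt ((r - la - ρ + δ)^2 + 4*δ*(la + ρ))))
    (y0 yL : ℝ) (hy0 : 0 < y0) (hyL : 0 < yL) (hy0L : y0 < yL)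
    (h1 h2 : ℝ → ℝ)
    (hh1 : ∀ y : ℝ, h1 y = (c/r) * (y - (y0/B1) * (y/y0) ^ B1))
    (hh2 : ∀ y : ℝ, h2 y = ρ/(la + ρ)
      - (c/r + L) * yL * (((1 - B4)/(B3 - B4)) * (y/yL) ^ B3
          + ((B3 - 1)/(B3 - B4)) * (y/yL) ^ B4)
      + (c/r) * y) :
    (∀ y ∈ Set.Ioo 0 y0,
        deriv (deriv h1) y = -(c/r) * ((B1 - 1)/y0) * (y/y0) ^ (B1 - 2) ∧
        deriv (deriv h1) y < 0) ∧
    (∀ y ∈ Set.Ioo y0 yL,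
        deriv (deriv h2) y
          = -(c/r + L) * (1/yL) * ((B3 - 1)*(1 - B4)/(B3 - B4))
              * (B3 * (y/yL) ^ (B3 - 2) - B4 * (y/yL) ^ (B4 - 2)) ∧
        deriv (deriv h2) y < 0) ∧
    StrictConcaveOn ℝ (Set.Ioo 0 y0) h1 ∧
    StrictConcaveOn ℝ (Set.Ioo y0 yL) h2 := by
  have hδ_pos : 0 < δ := by
    rw [hδ]
    have := div_pos (sub_pos.mpr hμ) hσ
    positivity
  have hB1_gt : 1 < B1 := hB1 ▸ one_lt_larger_root hδ_pos hr
  have hB3_gt : 1 < B3 := by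
    rw [hB3, sub_sub r la ρ]
    exact one_lt_larger_root hδ_pos hr
  have hB4_neg : B4 < 0 := hB4 ▸ smaller_root_neg hδ_pos (add_pos hla hρ)
  have hB34 : 0 < B3 - B4 := by linarith
  have hcr : 0 < c / r := div_pos hc hr
  have hh1_eq : h1 = fun x => 0 + c/r * x + (-(c/r) * (y0/B1)) * (x/y0) ^ B1
      + 0 * (x/y0) ^ (0 : ℝ) := by
    funext x
    rw [hh1]
    ring
  have hh2_eq : h2 = fun x => ρ/(la + ρ) + c/r * x
      + (-(c/r + L) * yL * ((1 - B4)/(B3 - B4))) * (x/yL) ^ B3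
      + (-(c/r + L) * yL * ((B3 - 1)/(B3 - B4))) * (x/yL) ^ B4 := by
    funext x
    rw [hh2]
    ring
  have hd1 : ∀ y ∈ Set.Ioo 0 y0,
      deriv (deriv h1) y = -(c/r) * ((B1 - 1)/y0) * (y/y0) ^ (B1 - 2) ∧
      deriv (deriv h1) y < 0 := by
    intro y hy
    have hd : deriv (deriv h1) y = -(c/r) * ((B1 - 1)/y0) * (y/y0) ^ (B1 - 2) := by
      rw [hh1_eq, deriv_deriv_affine_add_rpow _ _ _ _ _ _ hy0 hy.1]
      have : B1 ≠ 0 := by positivity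
      field_simp
      ring
    refine ⟨hd, ?_⟩
    have hpow := Real.rpow_pos_of_pos (div_pos hy.1 hy0) (B1 - 2)
    have hcoef : 0 < (B1 - 1)/y0 := div_pos (by linarith) hy0
    rw [hd, neg_mul, neg_mul, neg_lt_zero]
    positivity
  have hd2 : ∀ y ∈ Set.Ioo y0 yL,
      deriv (deriv h2) y
        = -(c/r + L) * (1/yL) * ((B3 - 1)*(1 - B4)/(B3 - B4))
            * (B3 * (y/yL) ^ (B3 - 2) - B4 * (y/yL) ^ (B4 - 2)) ∧
      deriv (deriv h2) y < 0 := by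
    intro y hy
    have hy_pos : 0 < y := hy0.trans hy.1
    have hd : deriv (deriv h2) y
        = -(c/r + L) * (1/yL) * ((B3 - 1)*(1 - B4)/(B3 - B4))
            * (B3 * (y/yL) ^ (B3 - 2) - B4 * (y/yL) ^ (B4 - 2)) := by
      rw [hh2_eq, deriv_deriv_affine_add_rpow _ _ _ _ _ _ hyL hy_pos]
      field_simp
      ring
    refine ⟨hd, ?_⟩
    have hpow3 := Real.rpow_pos_of_pos (div_pos hy_pos hyL) (B3 - 2)
    have hpow4 := Real.rpow_pos_of_pos (div_pos hy_pos hyL) (B4 - 2)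
    have hcoef : 0 < (B3 - 1)*(1 - B4)/(B3 - B4) :=
      div_pos (mul_pos (by linarith) (by linarith)) hB34
    have hbracket : 0 < B3 * (y/yL) ^ (B3 - 2) - B4 * (y/yL) ^ (B4 - 2) := by
      have := mul_pos (zero_lt_one.trans hB3_gt) hpow3
      have := mul_neg_of_neg_of_pos hB4_neg hpow4
      linarith
    rw [hd, neg_mul, neg_mul, neg_mul, neg_lt_zero]
    positivity
  refine ⟨hd1, hd2, ?_, ?_⟩
  · refine strictConcaveOn_of_deriv2_neg' (convex_Ioo _ _) ?_ fun y hy => (hd1 y hy).2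
    rw [hh1_eq]
    exact (continuousOn_affine_add_rpow _ _ _ _ _ _ hy0).mono fun y hy => hy.1
  · refine strictConcaveOn_of_deriv2_neg' (convex_Ioo _ _) ?_ fun y hy => (hd2 y hy).2
    rw [hh2_eq]
    exact (continuousOn_affine_add_rpow _ _ _ _ _ _ hyL).mono fun y hy => hy0.trans hy.1
end

section
/- Let z* ∈ (0, 1) satisfy g(z*) = 0. Then the quantity D := ((B3−1)/B3)·(c/r + L)·(z*)^{B4−1} + ((B1−B3)/(B1·B3))·(c/r) is strictly positive; define y0 = (ρ/(λ+ρ))/D > 0 and yL = y0/z*. Then value matching holds at y0: the function ĥ2(y) = ρ/(λ+ρ) − (c/r + L)·yL·[ ((1−B4)/(B3−B4))·(y/yL)^{B3} + ((B3−1)/(B3−B4))·(y/yL)^{B4} ] + (c/r)·y satisfies ĥ2(y0) = (c/r)·((B1−1)/B1)·y0, which is the value at y0 of the function ĥ1(y) = (c/r)·(y − (y0/B1)·(y/y0)^{B1}). -/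
/-- The larger root `B` of `δ x² - b x - q`, for `δ, q > 0`, satisfies its equation and is
positive. -/
lemma quadratic_pos_root {δ b q B : ℝ} (hδ : 0 < δ) (hq : 0 < q)
    (hB : B = (1 / (2 * δ)) * (b + Real.sqrt (b ^ 2 + 4 * δ * q))) :
    δ * B ^ 2 - b * B - q = 0 ∧ 0 < B := by
  have hs : Real.sqrt (b ^ 2 + 4 * δ * q) ^ 2 = b ^ 2 + 4 * δ * q :=
    Real.sq_sqrt (by positivity)
  have hlt : |b| < Real.sqrt (b ^ 2 + 4 * δ * q) :=
    Real.lt_sqrt_of_sq_lt (by rw [sq_abs]; linarith [mul_pos hδ hq])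
  constructor
  · generalize Real.sqrt (b ^ 2 + 4 * δ * q) = s at *
    rw [hB]
    field_simp
    linear_combination hs
  · rw [hB]
    have : 0 < b + Real.sqrt (b ^ 2 + 4 * δ * q) := by linarith [neg_abs_le b]
    positivity

/-- The smaller root of `δ x² - b x - q`, for `δ, q > 0`, is negative. -/
lemma quadratic_neg_root {δ b q B : ℝ} (hδ : 0 < δ) (hq : 0 < q)
    (hB : B = (1 / (2 * δ)) * (b - Real.sqrt (b ^ 2 + 4 * δ * q))) : B < 0 := by
  have h := quadratic_pos_root (b := -b) (B := -B) hδ hq (by rw [hB, neg_sq]; ring)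
  linarith [h.2]

/-- For `δ, q > 0`, a positive point where `δ x² - b x - q` is nonpositive lies to the left of
a positive point where it is nonnegative, if the two values differ. -/
lemma lt_of_quadratic_lt {δ b q x y : ℝ} (hδ : 0 < δ) (hq : 0 < q) (hx : 0 < x) (hy : 0 < y)
    (hfx : δ * x ^ 2 - b * x - q ≤ 0) (hfy : 0 ≤ δ * y ^ 2 - b * y - q)
    (h : δ * x ^ 2 - b * x - q < δ * y ^ 2 - b * y - q) : x < y := by
  have key : x * (δ * y ^ 2 - b * y - q) - y * (δ * x ^ 2 - b * x - q)
      = (y - x) * (δ * x * y + q) := by ring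
  have hpos : 0 < x * (δ * y ^ 2 - b * y - q) - y * (δ * x ^ 2 - b * x - q) := by
    rcases hfy.lt_or_eq with h' | h'
    · linarith [mul_pos hx h', mul_nonneg hy.le (neg_nonneg.2 hfx)]
    · rw [← h'] at h ⊢
      linarith [mul_pos hy (neg_pos.2 h)]
  rw [key] at hpos
  exact sub_pos.1 (pos_of_mul_pos_left hpos (by positivity))

/-- Value matching at y0: with z* a zero of g in (0,1), D > 0, y0 = (ρ/(λ+ρ))/D and
yL = y0/z*, the two pieces of the dual function agree at y0. -/
theorem stmt_7 (r μ σ la ρ c L : ℝ)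
    (hr : 0 < r) (hμ : r < μ) (hσ : 0 < σ) (hla : 0 < la) (hρ : 0 < ρ)
    (hc : 0 < c) (hL : 0 < L)
    (δ B1 B3 B4 : ℝ)
    (hδ : δ = (1/2) * ((μ - r)/σ)^2)
    (hB1 : B1 = (1/(2*δ)) * ((r - la + δ) + Real.sqrt ((r - la + δ)^2 + 4*δ*la)))
    (hB3 : B3 = (1/(2*δ)) * ((r - la - ρ + δ) + Real.sqrt ((r - la - ρ + δ)^2 + 4*δ*(la + ρ))))
    (hB4 : B4 = (1/(2*δ)) * ((r - la - ρ + δ) - Real.sqrt ((r - la - ρ + δ)^2 + 4*δ*(la + ρ))))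
    (g : ℝ → ℝ)
    (hg : ∀ z > 0, g z =
      (c/r + L) * ((B3*(1 - B4)/(B3 - B4)) * z ^ (B3 - 1)
        + (B4*(B3 - 1)/(B3 - B4)) * z ^ (B4 - 1)) - c/r)
    (zstar : ℝ) (hz : zstar ∈ Set.Ioo (0:ℝ) 1) (hgz : g zstar = 0)
    (D y0 yL : ℝ)
    (hD : D = ((B3 - 1)/B3) * (c/r + L) * zstar ^ (B4 - 1)
      + ((B1 - B3)/(B1*B3)) * (c/r))
    (hy0 : y0 = (ρ/(la + ρ)) / D) (hyL : yL = y0 / zstar)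
    (h1 h2 : ℝ → ℝ)
    (hh1 : ∀ y : ℝ, h1 y = (c/r) * (y - (y0/B1) * (y/y0) ^ B1))
    (hh2 : ∀ y : ℝ, h2 y = ρ/(la + ρ)
      - (c/r + L) * yL * (((1 - B4)/(B3 - B4)) * (y/yL) ^ B3
          + ((B3 - 1)/(B3 - B4)) * (y/yL) ^ B4)
      + (c/r) * y) :
    0 < D ∧ 0 < y0 ∧
      h2 y0 = (c/r) * ((B1 - 1)/B1) * y0 ∧
      h1 y0 = (c/r) * ((B1 - 1)/B1) * y0 := by
  have hσ' : 0 < (μ - r) / σ := div_pos (sub_pos.2 hμ) hσ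
  have hδ0 : 0 < δ := by rw [hδ]; positivity
  have hq : 0 < la + ρ := by positivity
  have hb : r - la - ρ + δ = r - (la + ρ) + δ := by ring
  rw [hb] at hB3 hB4
  obtain ⟨e1, p1⟩ := quadratic_pos_root hδ0 hla hB1
  obtain ⟨e3, p3⟩ := quadratic_pos_root hδ0 hq hB3
  have n4 : B4 < 0 := quadratic_neg_root hδ0 hq hB4
  have one_lt_B1 : 1 < B1 :=
    lt_of_quadratic_lt hδ0 hla one_pos p1 (by linarith) e1.ge (by linarith)
  have one_lt_B3 : 1 < B3 :=
    lt_of_quadratic_lt hδ0 hq one_pos p3 (by linarith) e3.ge (by linarith)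
  have hB1_val : 0 < δ * B1 ^ 2 - (r - (la + ρ) + δ) * B1 - (la + ρ) := by
    linarith [mul_pos hρ (sub_pos.2 one_lt_B1)]
  have B3_lt_B1 : B3 < B1 :=
    lt_of_quadratic_lt hδ0 hq p3 p1 e3.le hB1_val.le (by linarith)
  have hz0 : 0 < zstar := hz.1
  have hcr : 0 < c / r := div_pos hc hr
  have hDpos : 0 < D := by
    rw [hD]
    have := sub_pos.2 one_lt_B3
    have := sub_pos.2 B3_lt_B1
    positivity
  have hy0pos : 0 < y0 := by rw [hy0]; positivity
  refine ⟨hDpos, hy0pos, ?_, ?_⟩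
  · have hratio : y0 / yL = zstar := by rw [hyL]; field_simp
    have hDy : ρ / (la + ρ) = D * y0 := by rw [hy0]; field_simp
    have h34 : B3 - B4 ≠ 0 := by linarith
    have hpow : ∀ B : ℝ, zstar ^ B = zstar * zstar ^ (B - 1) := fun B => by
      rw [Real.rpow_sub_one hz0.ne']; field_simp
    rw [hg zstar hz0] at hgz
    rw [hh2, hratio, hDy, hD, hyL, hpow B3, hpow B4]
    generalize zstar ^ (B3 - 1) = P at *
    generalize zstar ^ (B4 - 1) = Q at *
    generalize c / r = k at *
    field_simp at hgz ⊢
    linear_combination -B1 * hgz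
  · rw [hh1, div_self hy0pos.ne', Real.one_rpow]
    field_simp
end

section
/- Let y0 > 0 and let w ∈ [0, c/r). Then the supremum over y ∈ [0, y0] of the quantity (c/r)·(y − (y0/B1)·(y/y0)^{B1}) − w·y equals (c·y0/(r·q))·(1 − r·w/c)^{q}, and this supremum is attained at the unique point y = y0·(1 − r·w/c)^{q−1} of [0, y0]. -/
/-- The largest root `x` of `a x² - b x + k = 0` with `a > 0` satisfies `x > 1` as soon as the
polynomial is negative at `1`. -/
theorem larger_root_spec {a b k d x : ℝ} (ha : 0 < a) (hd : d = b ^ 2 - 4 * a * k)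
    (h1 : a - b + k < 0) (hx : x = (1 / (2 * a)) * (b + Real.sqrt d)) :
    1 < x ∧ a * x ^ 2 - b * x + k = 0 := by
  have hlt : (2 * a - b) ^ 2 < d := by rw [hd]; nlinarith
  have hsq : Real.sqrt d ^ 2 = d := Real.sq_sqrt ((sq_nonneg _).trans hlt.le)
  have hroot : 2 * a - b < Real.sqrt d := Real.lt_sqrt_of_sq_lt hlt
  have hs : Real.sqrt d = 2 * a * x - b := by rw [hx]; field_simp; ring
  rw [hs] at hsq hroot
  constructor
  · nlinarith
  · have : 4 * a * (a * x ^ 2 - b * x + k) = 0 := by linear_combination hsq + hd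
    exact (mul_eq_zero.mp this).resolve_left (by positivity)

/-- The function `v - v ^ B / B` on `[0, ∞)` attains its strict maximum `1 - 1 / B` at `v = 1`. -/
theorem sub_rpow_div_lt {B v : ℝ} (hB : 1 < B) (hv : 0 ≤ v) (hv1 : v ≠ 1) :
    v - v ^ B / B < 1 - 1 / B := by
  have h := one_add_mul_self_lt_rpow_one_add (s := v - 1) (by linarith) (sub_ne_zero.mpr hv1) hB
  rw [add_sub_cancel] at h
  have hB0 : 0 < B := by linarith
  have e : 1 - 1 / B - (v - v ^ B / B) = (v ^ B - (1 + B * (v - 1))) / B := by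
    field_simp; ring
  have : 0 < (v ^ B - (1 + B * (v - 1))) / B := div_pos (by linarith) hB0
  linarith


/-- The Legendre transform of the first piece of the dual function: the supremum of
(c/r)(y − (y0/B1)(y/y0)^{B1}) − w·y over y ∈ [0, y0] equals (c·y0/(r·q))(1 − rw/c)^q,
attained at the unique point y0·(1 − rw/c)^{q−1}. -/
theorem stmt_8 (r μ σ la c L : ℝ)
    (hr : 0 < r) (hμ : r < μ) (hσ : 0 < σ) (hla : 0 < la) (hc : 0 < c) (hL : 0 < L)
    (δ B1 q : ℝ)
    (hδ : δ = (1/2) * ((μ - r)/σ)^2)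
    (hB1 : B1 = (1/(2*δ)) * ((r - la + δ) + Real.sqrt ((r - la + δ)^2 + 4*δ*la)))
    (hq : q = (1/(2*r)) * ((r + la + δ) + Real.sqrt ((r + la + δ)^2 - 4*r*la)))
    (y0 : ℝ) (hy0 : 0 < y0)
    (w : ℝ) (hw : w ∈ Set.Ico 0 (c/r))
    (f : ℝ → ℝ)
    (hf : ∀ y : ℝ, f y = (c/r) * (y - (y0/B1) * (y/y0) ^ B1) - w * y) :
    y0 * (1 - r*w/c) ^ (q - 1) ∈ Set.Icc 0 y0 ∧
      f (y0 * (1 - r*w/c) ^ (q - 1)) = (c*y0/(r*q)) * (1 - r*w/c) ^ q ∧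
      (∀ y ∈ Set.Icc 0 y0, f y ≤ (c*y0/(r*q)) * (1 - r*w/c) ^ q) ∧
      (∀ y ∈ Set.Icc 0 y0,
        f y = (c*y0/(r*q)) * (1 - r*w/c) ^ q → y = y0 * (1 - r*w/c) ^ (q - 1)) := by
  obtain ⟨hw0, hw1⟩ := hw
  have hδ0 : 0 < δ := by
    rw [hδ]
    have : 0 < (μ - r) / σ := div_pos (by linarith) hσ
    positivity
  obtain ⟨hB, hBeq⟩ := larger_root_spec (k := -la) hδ0 (by ring) (by linarith) hB1
  obtain ⟨hq1, hqeq⟩ := larger_root_spec (k := la) hr (by ring) (by linarith) hq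
  have hB0 : 0 < B1 := by linarith
  have hq0 : 0 < q := by linarith
  have hconj : (q - 1) * B1 = q := by
    have hfac : ((q - 1) * B1 - q) * (r * (q * (B1 - 1) + B1) - (r + la + δ) * (B1 - 1)) = 0 := by
      linear_combination (B1 - 1) ^ 2 * hqeq + hBeq
    rcases mul_eq_zero.mp hfac with h | h
    · linarith
    · have hcontra : r * (q - 1) = -(δ * (B1 - 1)) := by
        linear_combination (q - 1) * h - (B1 - 1) * hqeq
      have := mul_pos hr (sub_pos.mpr hq1)
      have := mul_pos hδ0 (sub_pos.mpr hB)
      linarith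
  set t := 1 - r * w / c with ht
  have hwc : w * r < c := (lt_div_iff₀ hr).mp hw1
  have ht0 : 0 < t := by
    have : r * w / c < 1 := (div_lt_one hc).mpr (by linarith)
    linarith
  have ht1 : t ≤ 1 := by
    have : 0 ≤ r * w / c := by positivity
    linarith
  have htp : 0 < t ^ (q - 1) := Real.rpow_pos_of_pos ht0 _
  have htq : 0 < t ^ q := Real.rpow_pos_of_pos ht0 _
  have hmul : t ^ (q - 1) * t = t ^ q := by
    rw [← Real.rpow_add_one ht0.ne', sub_add_cancel]
  have hpow : (t ^ (q - 1)) ^ B1 = t ^ q := by rw [← Real.rpow_mul ht0.le, hconj]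
  have hinv : 1 - 1 / B1 = 1 / q := by
    field_simp
    linarith
  have hwt : w = c / r * (1 - t) := by
    rw [ht]
    field_simp
    ring
  have key : ∀ v : ℝ, 0 ≤ v →
      f (y0 * t ^ (q - 1) * v) = c * y0 / r * t ^ q * (v - v ^ B1 / B1) := by
    intro v hv
    have hdiv : y0 * t ^ (q - 1) * v / y0 = t ^ (q - 1) * v := by field_simp
    rw [hf, hdiv, Real.mul_rpow htp.le hv, hpow, hwt, ← hmul]
    field_simp
    ring
  have hmax : f (y0 * t ^ (q - 1)) = c * y0 / (r * q) * t ^ q := by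
    have h := key 1 zero_le_one
    rw [mul_one, Real.one_rpow, hinv] at h
    rw [h]
    field_simp
  have hlt : ∀ y ∈ Set.Icc 0 y0, y ≠ y0 * t ^ (q - 1) →
      f y < c * y0 / (r * q) * t ^ q := by
    intro y hy hne
    have hz : 0 < y0 * t ^ (q - 1) := mul_pos hy0 htp
    have hv1 : y / (y0 * t ^ (q - 1)) ≠ 1 := fun h => hne ((div_eq_one_iff_eq hz.ne').mp h)
    have hv := div_nonneg hy.1 hz.le
    have hk := key _ hv
    rw [mul_div_cancel₀ _ hz.ne'] at hk
    have hs := sub_rpow_div_lt hB hv hv1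
    rw [hinv] at hs
    calc f y < c * y0 / r * t ^ q * (1 / q) := by
          rw [hk]
          exact mul_lt_mul_of_pos_left hs (by positivity)
      _ = c * y0 / (r * q) * t ^ q := by field_simp
  refine ⟨⟨by positivity, ?_⟩, hmax, fun y hy => ?_, fun y hy h => ?_⟩
  · exact mul_le_of_le_one_right hy0.le (Real.rpow_le_one ht0.le ht1 (by linarith))
  · rcases eq_or_ne y (y0 * t ^ (q - 1)) with rfl | hne
    · exact hmax.le
    · exact (hlt y hy hne).le
  · by_contra hne
    exact (hlt y hy hne).ne h
end

section
/- For every β > 0, the function u(w) = β·(1 − r·w/c)^{q} is strictly decreasing and strictly convex on (0, c/r), and it satisfies the Hamilton–Jacobi–Bellman equation λ·u(w) = (r·w − c)·u'(w) − δ·u'(w)²/u''(w) for every w ∈ (0, c/r). -/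
theorem hasDerivAt_mul_one_sub_div_rpow (k r c p w : ℝ)
    (h : 1 - r * w / c ≠ 0 ∨ 1 ≤ p) :
    HasDerivAt (fun w : ℝ => k * (1 - r * w / c) ^ p)
      (k * (-(r / c) * p) * (1 - r * w / c) ^ (p - 1)) w := by
  have hlin : HasDerivAt (fun w : ℝ => 1 - r * w / c) (-(r / c)) w := by
    simpa using (((hasDerivAt_id w).const_mul r).div_const c).const_sub 1
  exact ((hlin.rpow_const h).const_mul k).congr_deriv (by ring)

/-- The larger root of `r x² - (r + l + d) x + l` exceeds `1` when `r, d > 0`. -/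
theorem one_lt_and_quadratic_eq_zero_of_eq_larger_root {r l d q : ℝ}
    (hr : 0 < r) (hd : 0 < d)
    (hq : q = (1 / (2 * r)) * ((r + l + d) + Real.sqrt ((r + l + d) ^ 2 - 4 * r * l))) :
    1 < q ∧ r * q ^ 2 - (r + l + d) * q + l = 0 := by
  have hdisc : (r - l - d) ^ 2 < (r + l + d) ^ 2 - 4 * r * l := by
    nlinarith [mul_pos hr hd]
  have hsq := Real.sq_sqrt ((sq_nonneg _).trans hdisc.le)
  have hlt : r - l - d < Real.sqrt ((r + l + d) ^ 2 - 4 * r * l) :=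
    Real.lt_sqrt_of_sq_lt hdisc
  set s := Real.sqrt ((r + l + d) ^ 2 - 4 * r * l)
  have h2 : s = 2 * r * q - (r + l + d) := by
    rw [hq]
    field_simp
    ring
  constructor
  · by_contra! h
    nlinarith
  · rw [h2] at hsq
    have : 4 * r * (r * q ^ 2 - (r + l + d) * q + l) = 0 := by linarith
    simpa [hr.ne'] using this


/-- For β > 0, u(w) = β(1 − rw/c)^q is strictly decreasing and strictly convex on
(0, c/r) and satisfies the HJB equation λu = (rw − c)u' − δ u'²/u''. -/
theorem stmt_9 (r μ σ la c L : ℝ)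
    (hr : 0 < r) (hμ : r < μ) (hσ : 0 < σ) (hla : 0 < la) (hc : 0 < c) (hL : 0 < L)
    (δ q : ℝ)
    (hδ : δ = (1/2) * ((μ - r)/σ)^2)
    (hq : q = (1/(2*r)) * ((r + la + δ) + Real.sqrt ((r + la + δ)^2 - 4*r*la)))
    (β : ℝ) (hβ : 0 < β)
    (u : ℝ → ℝ) (hu : ∀ w : ℝ, u w = β * (1 - r*w/c) ^ q) :
    StrictAntiOn u (Set.Ioo 0 (c/r)) ∧
      StrictConvexOn ℝ (Set.Ioo 0 (c/r)) u ∧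
      (∀ w ∈ Set.Ioo (0:ℝ) (c/r),
        la * u w = (r*w - c) * deriv u w - δ * (deriv u w)^2 / deriv (deriv u) w) := by
  have hδ0 : 0 < δ := by
    have := div_pos (sub_pos.2 hμ) hσ
    rw [hδ]
    positivity
  obtain ⟨hq1, hroot⟩ := one_lt_and_quadratic_eq_zero_of_eq_larger_root hr hδ0 hq
  have hq0 : 0 < q - 1 := sub_pos.2 hq1
  have hqpos : 0 < q := by linarith
  have hpos : ∀ w ∈ Set.Ioo (0 : ℝ) (c / r), 0 < 1 - r * w / c := by
    intro w hw
    have := (lt_div_iff₀ hr).1 hw.2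
    rw [sub_pos, div_lt_one hc]
    linarith
  obtain rfl : u = fun w => β * (1 - r * w / c) ^ q := funext hu
  have hderiv : deriv (fun w : ℝ => β * (1 - r * w / c) ^ q) =
      fun w => β * (-(r / c) * q) * (1 - r * w / c) ^ (q - 1) :=
    funext fun w => (hasDerivAt_mul_one_sub_div_rpow β r c q w (Or.inr hq1.le)).deriv
  have hderiv2 : ∀ w ∈ Set.Ioo (0 : ℝ) (c / r),
      deriv (deriv fun w : ℝ => β * (1 - r * w / c) ^ q) w =
        β * (-(r / c) * q) * (-(r / c) * (q - 1)) * (1 - r * w / c) ^ (q - 1 - 1) := by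
    intro w hw
    rw [hderiv]
    exact (hasDerivAt_mul_one_sub_div_rpow _ r c _ w (Or.inl (hpos w hw).ne')).deriv
  have hcont : ContinuousOn (fun w : ℝ => β * (1 - r * w / c) ^ q) (Set.Ioo 0 (c / r)) :=
    fun w _ =>
      (hasDerivAt_mul_one_sub_div_rpow β r c q w (Or.inr hq1.le)).continuousAt.continuousWithinAt
  refine ⟨?_, ?_, ?_⟩
  · refine strictAntiOn_of_deriv_neg (convex_Ioo _ _) hcont fun w hw => ?_
    rw [interior_Ioo] at hw
    rw [hderiv]
    have hx := Real.rpow_pos_of_pos (hpos w hw) (q - 1)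
    have : 0 < β * (r / c * q) * (1 - r * w / c) ^ (q - 1) := by positivity
    linarith
  · refine strictConvexOn_of_deriv2_pos (convex_Ioo _ _) hcont fun w hw => ?_
    rw [interior_Ioo] at hw
    have hx := Real.rpow_pos_of_pos (hpos w hw) (q - 1 - 1)
    have : 0 < β * (r / c * q) * (r / c * (q - 1)) * (1 - r * w / c) ^ (q - 1 - 1) := by
      positivity
    rw [Function.iterate_succ_apply, Function.iterate_one, hderiv2 w hw]
    linarith
  · intro w hw
    have hx := hpos w hw
    rw [hderiv2 w hw, hderiv]
    have hrw : r * w - c = -c * (1 - r * w / c) := by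
      field_simp
      ring
    rw [hrw]
    beta_reduce
    generalize 1 - r * w / c = x at hx ⊢
    have hy := Real.rpow_pos_of_pos hx (q - 1 - 1)
    have e1 : x ^ (q - 1) = x ^ (q - 1 - 1) * x := by
      rw [← Real.rpow_add_one hx.ne', sub_add_cancel]
    have e2 : x ^ q = x ^ (q - 1) * x := by
      rw [← Real.rpow_add_one hx.ne', sub_add_cancel]
    rw [e2, e1]
    generalize x ^ (q - 1 - 1) = y at hy ⊢
    field_simp
    linear_combination -hroot
end

section
/- Suppose ψ : (−L, 0) → ℝ is three times differentiable with ψ'(w) < 0 and ψ''(w) > 0 for all w ∈ (−L, 0), and suppose ψ satisfies (λ+ρ)·ψ(w) − ρ = (r·w − c)·ψ'(w) − δ·ψ'(w)²/ψ''(w) for all w ∈ (−L, 0). Then the function π(w) = −((μ−r)/σ²)·ψ'(w)/ψ''(w) is differentiable on (−L, 0) and satisfies the first-order differential equation π'(w) = (2/(μ−r))·(λ + ρ + δ − r) − (2/σ²)·(c − r·w)/π(w) for all w ∈ (−L, 0). -/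
/-- If ψ solves the HJB ODE on (−L, 0) with ψ' < 0 and ψ'' > 0, then
π(w) = −((μ−r)/σ²)ψ'/ψ'' is differentiable and solves
π' = (2/(μ−r))(λ+ρ+δ−r) − (2/σ²)(c − rw)/π. -/
theorem stmt_11 (r μ σ la ρ c L : ℝ)
    (hr : 0 < r) (hμ : r < μ) (hσ : 0 < σ) (hla : 0 < la) (hρ : 0 < ρ)
    (hc : 0 < c) (hL : 0 < L)
    (δ : ℝ) (hδ : δ = (1/2) * ((μ - r)/σ)^2)
    (ψ : ℝ → ℝ)
    (hdiff1 : ∀ w ∈ Set.Ioo (-L) 0, DifferentiableAt ℝ ψ w)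
    (hdiff2 : ∀ w ∈ Set.Ioo (-L) 0, DifferentiableAt ℝ (deriv ψ) w)
    (hdiff3 : ∀ w ∈ Set.Ioo (-L) 0, DifferentiableAt ℝ (deriv (deriv ψ)) w)
    (hψ' : ∀ w ∈ Set.Ioo (-L) 0, deriv ψ w < 0)
    (hψ'' : ∀ w ∈ Set.Ioo (-L) 0, 0 < deriv (deriv ψ) w)
    (hODE : ∀ w ∈ Set.Ioo (-L) 0,
      (la + ρ) * ψ w - ρ
        = (r*w - c) * deriv ψ w - δ * (deriv ψ w)^2 / deriv (deriv ψ) w)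
    (π : ℝ → ℝ)
    (hπ : ∀ w : ℝ, π w = -((μ - r)/σ^2) * deriv ψ w / deriv (deriv ψ) w) :
    ∀ w ∈ Set.Ioo (-L) 0,
      DifferentiableAt ℝ π w ∧
      deriv π w = (2/(μ - r)) * (la + ρ + δ - r) - (2/σ^2) * (c - r*w) / π w := by
  intro w hw
  have hp : deriv ψ w ≠ 0 := (hψ' w hw).ne
  have hq : deriv (deriv ψ) w ≠ 0 := (hψ'' w hw).ne'
  have hm : μ - r ≠ 0 := (sub_pos.2 hμ).ne'
  have h1 := (hdiff1 w hw).hasDerivAt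
  have h2 := (hdiff2 w hw).hasDerivAt
  have h3 := (hdiff3 w hw).hasDerivAt
  have hπd := ((h2.const_mul (-((μ - r)/σ^2))).fun_div h3 hq).congr_of_eventuallyEq
    (Filter.Eventually.of_forall hπ)
  have hlhs := (h1.const_mul (la + ρ)).sub_const ρ
  have hrhs := ((((hasDerivAt_id' w).const_mul r).sub_const c).fun_mul h2).fun_sub
    (((h2.fun_pow 2).const_mul δ).fun_div h3 hq)
  have hdODE := hlhs.unique (hrhs.congr_of_eventuallyEq
    (Filter.eventually_of_mem (isOpen_Ioo.mem_nhds hw) hODE))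
  refine ⟨hπd.differentiableAt, ?_⟩
  rw [hπd.deriv, hπ w, hδ]
  rw [hδ] at hdODE
  generalize deriv (deriv (deriv ψ)) w = t at *
  generalize deriv (deriv ψ) w = q at *
  generalize deriv ψ w = p at *
  generalize μ - r = m at *
  field_simp at hdODE ⊢
  push_cast at hdODE
  linear_combination -hdODE
end

section
/- Let 0 < ρ1 < ρ2, and for i = 1, 2 let π_i : (−L, 0) → (0, ∞) be a differentiable function satisfying π_i'(w) = (2/(μ−r))·(λ + ρ_i + δ − r) − (2/σ²)·(c − r·w)/π_i(w) for all w ∈ (−L, 0), together with the boundary condition lim_{w ↓ −L} π_i(w) = (2r/(μ−r))·(c/r + L). Then π_1(w) < π_2(w) for all w ∈ (−L, 0). -/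
theorem pos_of_deriv_pos_of_pos {f : ℝ → ℝ} {a b : ℝ} (hab : a ≤ b)
    (hf : ∀ x ∈ Set.Icc a b, DifferentiableAt ℝ f x)
    (hf' : ∀ x ∈ Set.Icc a b, 0 < f x → 0 < deriv f x) (ha : 0 < f a) : 0 < f b := by
  by_contra! hb
  obtain ⟨m, hm, hmax⟩ := isCompact_Icc.exists_isMaxOn (Set.nonempty_Icc.2 hab)
    (fun x hx => (hf x hx).continuousAt.continuousWithinAt)
  have hfm : 0 < f m := ha.trans_le (hmax (Set.left_mem_Icc.2 hab))
  have hmb : m < b := lt_of_le_of_ne hm.2 (by rintro rfl; exact hfm.not_ge hb)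
  have hslope := ((hf m hm).hasDerivAt.tendsto_slope.mono_left
    (nhdsGT_le_nhdsNE m)).eventually_const_lt (hf' m hm hfm)
  obtain ⟨x, hx, hmx, hxb⟩ := (hslope.and (Ioo_mem_nhdsGT hmb)).exists
  rw [slope_def_field] at hx
  have hle : f x ≤ f m := hmax ⟨hm.1.trans hmx.le, hxb.le⟩
  exact hx.not_ge (div_nonpos_of_nonpos_of_nonneg (by linarith) (by linarith))

theorem pos_near_left_of_tendsto_zero_of_deriv_pos {f : ℝ → ℝ} {a b : ℝ}
    (hf : ∀ x ∈ Set.Ioo a b, DifferentiableAt ℝ f x)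
    (hlim : Filter.Tendsto f (nhdsWithin a (Set.Ioi a)) (nhds 0))
    (hf' : ∀ x ∈ Set.Ioo a b, 0 < deriv f x) {x : ℝ} (hx : x ∈ Set.Ioo a b) : 0 < f x := by
  have hmono : StrictMonoOn f (Set.Ioo a b) := by
    refine strictMonoOn_of_deriv_pos (convex_Ioo a b)
      (fun y hy => (hf y hy).continuousAt.continuousWithinAt) ?_
    rwa [interior_Ioo]
  obtain ⟨y, hay, hyx⟩ := exists_between hx.1
  have hy : y ∈ Set.Ioo a b := ⟨hay, hyx.trans hx.2⟩
  have h0 : 0 ≤ f y := by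
    refine le_of_tendsto hlim ?_
    filter_upwards [Ioo_mem_nhdsGT hay] with z hz
    exact (hmono ⟨hz.1, hz.2.trans hy.2⟩ hy hz.2).le
  exact h0.trans_lt (hmono hy hx hyx)

/-- Comparison of optimal investment strategies: if 0 < ρ1 < ρ2 and π₁, π₂ are
positive solutions of the corresponding first-order ODEs on (−L, 0) with the same
boundary value at −L, then π₁ < π₂ on (−L, 0). -/
theorem stmt_12 (r μ σ la c L : ℝ)
    (hr : 0 < r) (hμ : r < μ) (hσ : 0 < σ) (hla : 0 < la) (hc : 0 < c) (hL : 0 < L)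
    (δ : ℝ) (hδ : δ = (1/2) * ((μ - r)/σ)^2)
    (ρ1 ρ2 : ℝ) (hρ1 : 0 < ρ1) (hρ12 : ρ1 < ρ2)
    (π1 π2 : ℝ → ℝ)
    (hpos1 : ∀ w ∈ Set.Ioo (-L) 0, 0 < π1 w)
    (hpos2 : ∀ w ∈ Set.Ioo (-L) 0, 0 < π2 w)
    (hdiff1 : ∀ w ∈ Set.Ioo (-L) 0, DifferentiableAt ℝ π1 w)
    (hdiff2 : ∀ w ∈ Set.Ioo (-L) 0, DifferentiableAt ℝ π2 w)
    (hODE1 : ∀ w ∈ Set.Ioo (-L) 0,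
      deriv π1 w = (2/(μ - r)) * (la + ρ1 + δ - r) - (2/σ^2) * (c - r*w) / π1 w)
    (hODE2 : ∀ w ∈ Set.Ioo (-L) 0,
      deriv π2 w = (2/(μ - r)) * (la + ρ2 + δ - r) - (2/σ^2) * (c - r*w) / π2 w)
    (hbdry1 : Filter.Tendsto π1 (nhdsWithin (-L) (Set.Ioi (-L)))
      (nhds ((2*r/(μ - r)) * (c/r + L))))
    (hbdry2 : Filter.Tendsto π2 (nhdsWithin (-L) (Set.Ioi (-L)))
      (nhds ((2*r/(μ - r)) * (c/r + L)))) :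
    ∀ w ∈ Set.Ioo (-L) 0, π1 w < π2 w := by
  have hμr : 0 < μ - r := sub_pos.2 hμ
  have hdiff : ∀ w ∈ Set.Ioo (-L) 0, DifferentiableAt ℝ (fun x => π2 x - π1 x) w :=
    fun w hw => (hdiff2 w hw).fun_sub (hdiff1 w hw)
  have hderiv : ∀ w ∈ Set.Ioo (-L) 0, deriv (fun x => π2 x - π1 x) w =
      2 / (μ - r) * (ρ2 - ρ1) + 2 / σ ^ 2 * (c - r * w) * (π2 w - π1 w) / (π1 w * π2 w) := by
    intro w hw
    have h1 := (hpos1 w hw).ne'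
    have h2 := (hpos2 w hw).ne'
    rw [deriv_fun_sub (hdiff2 w hw) (hdiff1 w hw), hODE1 w hw, hODE2 w hw]
    field_simp
    ring
  have hA : 0 < 2 / (μ - r) * (ρ2 - ρ1) := mul_pos (by positivity) (sub_pos.2 hρ12)
  have hb : 0 < 2 * r / (μ - r) * (c / r + L) := by positivity
  have hlim : Filter.Tendsto (fun x => π2 x - π1 x) (nhdsWithin (-L) (Set.Ioi (-L)))
      (nhds 0) := by
    simpa using hbdry2.sub hbdry1
  have hcoef : Filter.Tendsto (fun w => 2 / σ ^ 2 * (c - r * w))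
      (nhdsWithin (-L) (Set.Ioi (-L))) (nhds (2 / σ ^ 2 * (c - r * (-L)))) :=
    (Continuous.tendsto (by fun_prop) (-L)).mono_left nhdsWithin_le_nhds
  have hderiv_lim := ((hcoef.mul hlim).div (hbdry1.mul hbdry2)
    (mul_pos hb hb).ne').const_add (2 / (μ - r) * (ρ2 - ρ1))
  rw [mul_zero, zero_div, add_zero] at hderiv_lim
  obtain ⟨s, hs, hsub⟩ := (mem_nhdsGT_iff_exists_Ioo_subset).1
    ((hderiv_lim.eventually_const_lt hA).and (Ioo_mem_nhdsGT (neg_lt_zero.2 hL)))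
  intro w hw
  obtain ⟨x, hLx, hx⟩ := exists_between (lt_min hs hw.1)
  have hxpos : 0 < π2 x - π1 x :=
    pos_near_left_of_tendsto_zero_of_deriv_pos (fun y hy => hdiff y (hsub hy).2) hlim
      (fun y hy => (hsub hy).1.trans_eq (hderiv y (hsub hy).2).symm)
      ⟨hLx, hx.trans_le (min_le_left _ _)⟩
  have hIcc : ∀ y ∈ Set.Icc x w, y ∈ Set.Ioo (-L) 0 :=
    fun y hy => ⟨hLx.trans_le hy.1, hy.2.trans_lt hw.2⟩
  refine sub_pos.1 (pos_of_deriv_pos_of_pos (f := fun x => π2 x - π1 x)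
    (hx.le.trans (min_le_right _ _))
    (fun y hy => hdiff y (hIcc y hy)) (fun y hy hpos => ?_) hxpos)
  have hy := hIcc y hy
  have hcy : 0 < c - r * y := by nlinarith [hy.2]
  have h1 := hpos1 y hy
  have h2 := hpos2 y hy
  have hpos : 0 < π2 y - π1 y := hpos
  rw [hderiv y hy]
  positivity
end

section
/- Define α = ((q−1)/(2δ))·[−(r−λ+δ) + √((r−λ+δ)² + 4δ(λ+ρ))]. Then α > 0. Define π0(w) = ((μ−r)/σ²)·(c/r − w)/(q−1), and define ψ0 : (−∞, c/r] → ℝ by ψ0(w) = (ρ/(λ+ρ))·[1 − (q/(q+α))·(1 − r·w/c)^{−α}] for w < 0 and ψ0(w) = (ρ/(λ+ρ))·(α/(q+α))·(1 − r·w/c)^{q} for 0 ≤ w ≤ c/r. Then: (i) ψ0 is continuous on (−∞, c/r] and differentiable at 0 (the two pieces have equal values and equal first derivatives at 0); (ii) for every w ∈ (−∞, 0), λ·ψ0(w) + ρ·(ψ0(w) − 1) = (r·w − c + (μ−r)·π0(w))·ψ0'(w) + (1/2)·σ²·π0(w)²·ψ0''(w); (iii) for every w ∈ (0, c/r), λ·ψ0(w)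 = (r·w − c + (μ−r)·π0(w))·ψ0'(w) + (1/2)·σ²·π0(w)²·ψ0''(w); (iv) ψ0(c/r) = 0 and ψ0(w) → ρ/(λ+ρ) as w → −∞. -/
open Filter Topology Set

/-- Derivative of the affine-power profile `A + B (1 - r w / c) ^ p`. -/
theorem hasDerivAt_affine_rpow (r c A B p w : ℝ) (hw : 0 < 1 - r * w / c) :
    HasDerivAt (fun x : ℝ => A + B * (1 - r * x / c) ^ p)
      (B * p * (-(r / c)) * (1 - r * w / c) ^ (p - 1)) w := by
  have h1 : HasDerivAt (fun x : ℝ => 1 - r * x / c) (-(r * 1 / c)) w :=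
    (((hasDerivAt_id w).const_mul r).div_const c).const_sub 1
  refine (((h1.rpow_const (p := p) (Or.inl hw.ne')).const_mul B).const_add A).congr_deriv ?_
  ring

/-- On an open set where `f` is an affine-power profile, its first and second derivatives are
those of the profile. -/
theorem derivs_of_eqOn_affine_rpow {f : ℝ → ℝ} {s : Set ℝ} (hs : IsOpen s) (r c A B p : ℝ)
    (hpos : ∀ x ∈ s, 0 < 1 - r * x / c)
    (hf : ∀ x ∈ s, f x = A + B * (1 - r * x / c) ^ p) {w : ℝ} (hw : w ∈ s) :
    deriv f w = B * p * (-(r / c)) * (1 - r * w / c) ^ (p - 1) ∧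
      deriv (deriv f) w = B * p * (p - 1) * (r / c) ^ 2 * (1 - r * w / c) ^ (p - 2) := by
  have hd : ∀ x ∈ s, deriv f x = B * p * (-(r / c)) * (1 - r * x / c) ^ (p - 1) := by
    intro x hx
    refine ((hasDerivAt_affine_rpow r c A B p x (hpos x hx)).congr_of_eventuallyEq ?_).deriv
    filter_upwards [hs.mem_nhds hx] with y hy using hf y hy
  refine ⟨hd w hw, ?_⟩
  have h2 := (hasDerivAt_affine_rpow r c 0 (B * p * (-(r / c))) (p - 1) w
    (hpos w hw)).congr_of_eventuallyEq (f₁ := deriv f) (by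
      filter_upwards [hs.mem_nhds hw] with y hy
      rw [hd y hy, zero_add])
  rw [h2.deriv, show p - 1 - 1 = p - 2 by ring]
  ring

/-- The generator of the wealth process, controlled by a strategy linear in the distance to the
safe level, acts on `B u ^ p` as multiplication by a constant. -/
theorem generator_rpow {r m σ c δ q p u B : ℝ} (hr : r ≠ 0) (hσ : σ ≠ 0) (hc : c ≠ 0)
    (hq : q - 1 ≠ 0) (hu : 0 < u) (hδ : δ = (1 / 2) * (m / σ) ^ 2) :
    (-(c * u) + m * ((m / σ ^ 2) * (c / r * u) / (q - 1))) *
        (B * p * (-(r / c)) * u ^ (p - 1)) +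
      (1 / 2) * σ ^ 2 * ((m / σ ^ 2) * (c / r * u) / (q - 1)) ^ 2 *
        (B * p * (p - 1) * (r / c) ^ 2 * u ^ (p - 2)) =
      B * (p * (r - 2 * δ / (q - 1)) + δ * p * (p - 1) / (q - 1) ^ 2) * u ^ p := by
  have e1 : u ^ (p - 1) = u ^ p / u := by rw [Real.rpow_sub hu, Real.rpow_one]
  have e2 : u ^ (p - 2) = u ^ p / u ^ 2 := by
    rw [Real.rpow_sub hu, Real.rpow_two]
  have hu' := hu.ne'
  rw [e1, e2, hδ]
  field_simp
  ring

/-- The exponent `q` exceeds one and solves its characteristic equation. -/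
theorem one_lt_and_quadratic {r la δ q : ℝ} (hr : 0 < r) (hδ : 0 < δ)
    (hq : q = (1/(2*r)) * ((r + la + δ) + Real.sqrt ((r + la + δ)^2 - 4*r*la))) :
    1 < q ∧ r * q ^ 2 - (r + la + δ) * q + la = 0 := by
  have hD : (r + la + δ)^2 - 4*r*la = (r - la - δ)^2 + 4*r*δ := by ring
  have hrδ : 0 < r * δ := mul_pos hr hδ
  have hs := Real.sq_sqrt (show 0 ≤ (r + la + δ)^2 - 4*r*la by rw [hD]; positivity)
  have hlt : r - la - δ < Real.sqrt ((r + la + δ)^2 - 4*r*la) :=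
    Real.lt_sqrt_of_sq_lt (by rw [hD]; linarith)
  set s := Real.sqrt ((r + la + δ)^2 - 4*r*la)
  have hsq : s = 2 * r * q - (r + la + δ) := by
    rw [hq]; field_simp; ring
  constructor
  · have : 0 < r * (q - 1) := by linarith
    linarith [pos_of_mul_pos_right this hr.le]
  · rw [hsq] at hs
    have : r * (r * q ^ 2 - (r + la + δ) * q + la) = 0 := by linear_combination hs / 4
    exact (mul_eq_zero.mp this).resolve_left hr.ne'

/-- The exponent `α` is positive and `α / (q - 1)` solves its characteristic equation. -/
theorem pos_and_quadratic {b δ k q α : ℝ} (hδ : 0 < δ) (hk : 0 < k) (hq : 1 < q)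
    (hα : α = ((q - 1)/(2*δ)) * (-b + Real.sqrt (b^2 + 4*δ*k))) :
    0 < α ∧ δ * α ^ 2 + b * α * (q - 1) = k * (q - 1) ^ 2 := by
  have hδk : 0 < δ * k := mul_pos hδ hk
  have hs := Real.sq_sqrt (show 0 ≤ b^2 + 4*δ*k by nlinarith [sq_nonneg b])
  have hlt : b < Real.sqrt (b^2 + 4*δ*k) := Real.lt_sqrt_of_sq_lt (by linarith)
  set s := Real.sqrt (b^2 + 4*δ*k)
  have hq' : 0 < q - 1 := by linarith
  constructor
  · rw [hα]
    exact mul_pos (by positivity) (by linarith)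
  · rw [hα]
    field_simp
    linear_combination hs

/-- The constrained minimum probability of lifetime exponential Parisian ruin ψ0:
α > 0, ψ0 is continuous on (−∞, c/r], differentiable at 0, solves the HJB equation
with π = π0 on (−∞, 0) and on (0, c/r), vanishes at c/r, and tends to ρ/(λ+ρ)
as w → −∞. -/
theorem stmt_16 (r μ σ la ρ c : ℝ)
    (hr : 0 < r) (hμ : r < μ) (hσ : 0 < σ) (hla : 0 < la) (hρ : 0 < ρ) (hc : 0 < c)
    (δ q α : ℝ)
    (hδ : δ = (1/2) * ((μ - r)/σ)^2)
    (hq : q = (1/(2*r)) * ((r + la + δ) + Real.sqrt ((r + la + δ)^2 - 4*r*la)))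
    (hα : α = ((q - 1)/(2*δ))
      * (-(r - la + δ) + Real.sqrt ((r - la + δ)^2 + 4*δ*(la + ρ))))
    (π0 ψ0 : ℝ → ℝ)
    (hπ0 : ∀ w : ℝ, π0 w = ((μ - r)/σ^2) * (c/r - w) / (q - 1))
    (hψ0neg : ∀ w : ℝ, w < 0 →
      ψ0 w = (ρ/(la + ρ)) * (1 - (q/(q + α)) * (1 - r*w/c) ^ (-α)))
    (hψ0pos : ∀ w : ℝ, 0 ≤ w → w ≤ c/r →
      ψ0 w = (ρ/(la + ρ)) * (α/(q + α)) * (1 - r*w/c) ^ q) :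
    0 < α ∧
      ContinuousOn ψ0 (Set.Iic (c/r)) ∧
      DifferentiableAt ℝ ψ0 0 ∧
      (∀ w : ℝ, w < 0 →
        la * ψ0 w + ρ * (ψ0 w - 1)
          = (r*w - c + (μ - r) * π0 w) * deriv ψ0 w
            + (1/2) * σ^2 * (π0 w)^2 * deriv (deriv ψ0) w) ∧
      (∀ w ∈ Set.Ioo (0:ℝ) (c/r),
        la * ψ0 w
          = (r*w - c + (μ - r) * π0 w) * deriv ψ0 w
            + (1/2) * σ^2 * (π0 w)^2 * deriv (deriv ψ0) w) ∧
      ψ0 (c/r) = 0 ∧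
      Filter.Tendsto ψ0 Filter.atBot (nhds (ρ/(la + ρ))) := by
  have hm : 0 < μ - r := sub_pos.mpr hμ
  have hδ0 : 0 < δ := by rw [hδ]; positivity
  obtain ⟨hq1, hqeq⟩ := one_lt_and_quadratic hr hδ0 hq
  obtain ⟨hα0, hαeq⟩ := pos_and_quadratic hδ0 (add_pos hla hρ) hq1 hα
  have hq0 : 0 < q := by linarith
  have hqm : q - 1 ≠ 0 := by linarith
  have hqα : q + α ≠ 0 := by positivity
  have hlρ : la + ρ ≠ 0 := by positivity
  have hcr : 0 < c / r := by positivity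
  have hu : ∀ w : ℝ, w < c / r → 0 < 1 - r * w / c := by
    intro w hw
    rw [lt_div_iff₀ hr] at hw
    rw [sub_pos, div_lt_one hc]
    linarith
  have hneg : ∀ w : ℝ, w < 0 → ψ0 w = ρ / (la + ρ) +
      (-(ρ / (la + ρ) * (q / (q + α)))) * (1 - r * w / c) ^ (-α) := by
    intro w hw
    rw [hψ0neg w hw]
    ring
  have hpos : ∀ w : ℝ, 0 ≤ w → w ≤ c / r → ψ0 w =
      0 + (ρ / (la + ρ) * (α / (q + α))) * (1 - r * w / c) ^ q := by
    intro w h0 h1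
    rw [hψ0pos w h0 h1, zero_add]
  have hzero : ψ0 0 = ρ / (la + ρ) +
      (-(ρ / (la + ρ) * (q / (q + α)))) * (1 - r * 0 / c) ^ (-α) := by
    rw [hpos 0 le_rfl hcr.le]
    simp only [mul_zero, zero_div, sub_zero, Real.one_rpow]
    field_simp
    ring
  have hdrift : ∀ w : ℝ, r * w - c = -(c * (1 - r * w / c)) := by
    intro w; field_simp; ring
  have hdist : ∀ w : ℝ, c / r - w = c / r * (1 - r * w / c) := by
    intro w; field_simp
  have hdiff : DifferentiableAt ℝ ψ0 0 := by
    have hl := (hasDerivAt_affine_rpow r c (ρ / (la + ρ))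
      (-(ρ / (la + ρ) * (q / (q + α)))) (-α) 0 (hu 0 hcr)).hasDerivWithinAt (s := Iic 0)
    have hR := (hasDerivAt_affine_rpow r c 0
      (ρ / (la + ρ) * (α / (q + α))) q 0 (hu 0 hcr)).hasDerivWithinAt (s := Ici 0)
    have hl' := hl.congr_of_eventuallyEq (f₁ := ψ0) (by
      filter_upwards [self_mem_nhdsWithin] with x hx
      rcases (mem_Iic.mp hx).lt_or_eq with h | rfl
      · exact hneg x h
      · exact hzero) hzero
    have hR' := hR.congr_of_eventuallyEq (f₁ := ψ0) (by
      filter_upwards [self_mem_nhdsWithin, mem_nhdsWithin_of_mem_nhds (Iio_mem_nhds hcr)]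
        with x hx hx'
      exact hpos x hx (mem_Iio.mp hx').le) (hpos 0 le_rfl hcr.le)
    simp only [mul_zero, zero_div, sub_zero, Real.one_rpow, mul_one] at hl' hR'
    have hslope : -(ρ / (la + ρ) * (q / (q + α))) * -α * -(r / c) =
        ρ / (la + ρ) * (α / (q + α)) * q * -(r / c) := by ring
    rw [hslope] at hl'
    have := hl'.union hR'
    rw [Iic_union_Ici, hasDerivWithinAt_univ] at this
    exact this.differentiableAt
  refine ⟨hα0, ?_, hdiff, ?_, ?_, ?_, ?_⟩
  · intro w hw
    rcases lt_trichotomy w 0 with h | rfl | h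
    · refine ((hasDerivAt_affine_rpow r c (ρ / (la + ρ))
        (-(ρ / (la + ρ) * (q / (q + α)))) (-α) w
        (hu w (h.trans hcr))).continuousAt.congr ?_).continuousWithinAt
      filter_upwards [Iio_mem_nhds h] with x hx using (hneg x hx).symm
    · exact hdiff.continuousAt.continuousWithinAt
    · have hcont : Continuous fun x : ℝ =>
          0 + (ρ / (la + ρ) * (α / (q + α))) * (1 - r * x / c) ^ q :=
        continuous_const.add (continuous_const.mul
          ((by fun_prop : Continuous fun x : ℝ => 1 - r * x / c).rpow_const
            fun _ => Or.inr hq0.le))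
      refine hcont.continuousWithinAt.congr_of_eventuallyEq ?_ (hpos w h.le hw)
      filter_upwards [self_mem_nhdsWithin, mem_nhdsWithin_of_mem_nhds (Ioi_mem_nhds h)]
        with x hx hx'
      exact hpos x (mem_Ioi.mp hx').le hx
  · intro w hw
    obtain ⟨h1, h2⟩ := derivs_of_eqOn_affine_rpow isOpen_Iio r c _ _ _
      (fun x hx => hu x ((mem_Iio.mp hx).trans hcr)) hneg hw
    rw [h1, h2, hπ0, hdist, hdrift,
      generator_rpow hr.ne' hσ.ne' hc.ne' hqm (hu w (hw.trans hcr)) hδ, hneg w hw]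
    have hchar : -α * (r - 2 * δ / (q - 1)) + δ * -α * (-α - 1) / (q - 1) ^ 2 = la + ρ := by
      field_simp
      linear_combination hαeq - α * hqeq
    rw [hchar]
    field_simp
    ring
  · intro w hw
    obtain ⟨h1, h2⟩ := derivs_of_eqOn_affine_rpow isOpen_Ioo r c _ _ _
      (fun x hx => hu x hx.2) (fun x hx => hpos x hx.1.le hx.2.le) hw
    rw [h1, h2, hπ0, hdist, hdrift,
      generator_rpow hr.ne' hσ.ne' hc.ne' hqm (hu w hw.2) hδ, hpos w hw.1.le hw.2.le]
    have hchar : q * (r - 2 * δ / (q - 1)) + δ * q * (q - 1) / (q - 1) ^ 2 = la := by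
      field_simp
      linear_combination hqeq
    rw [hchar]
    ring
  · rw [hpos _ hcr.le le_rfl, show 1 - r * (c / r) / c = 0 by field_simp; simp,
      Real.zero_rpow hq0.ne']
    simp
  · have hlin : Tendsto (fun w : ℝ => 1 - r * w / c) atBot atTop := by
      have : Tendsto (fun w : ℝ => 1 + (r / c) * (-w)) atBot atTop :=
        tendsto_atTop_add_const_left _ _
          (tendsto_neg_atBot_atTop.const_mul_atTop (by positivity))
      refine this.congr fun w => ?_
      ring
    have hlim := (((tendsto_rpow_neg_atTop hα0).comp hlin).const_mul
      (-(ρ / (la + ρ) * (q / (q + α))))).const_add (ρ / (la + ρ))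
    rw [mul_zero, add_zero] at hlim
    refine hlim.congr' ?_
    filter_upwards [Iio_mem_atBot (0 : ℝ)] with w hw using (hneg w hw).symm
end

section
/- Let u, v ∈ 𝒞 satisfy: (i) F(w, u(w), u'(w), u''(w)) < F(w, v(w), v'(w), v''(w)) for every w ∈ (−L, 0) ∪ (0, c/r); (ii) at w = 0, both F(0, u(0), u'(0), u''(0−)) < F(0, v(0), v'(0), v''(0−)) with the indicator 1_{w<0} taken equal to 1, and F(0, u(0), u'(0), u''(0+)) < F(0, v(0), v'(0), v''(0+)) with the indicator taken equal to 0; (iii) u(−L) ≤ v(−L) and u(c/r) ≤ v(c/r). Then u(w) < v(w) for every w ∈ (−L, c/r). -/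
open Set Filter Topology in
/-- Second-order necessary condition at a one-sided maximum: a stationary point `x` that is
maximal on `[x, b)` has nonpositive right second derivative. -/
theorem right_second_deriv_nonpos_of_right_max {f g : ℝ → ℝ} {x b A : ℝ} (hxb : x < b)
    (hf : ContinuousOn f (Ico x b)) (hfg : ∀ y ∈ Ioo x b, HasDerivAt f (g y) y)
    (hgx : g x = 0) (hg : HasDerivWithinAt g A (Ioi x) x)
    (hmax : ∀ y ∈ Ioo x b, f y ≤ f x) : A ≤ 0 := by
  by_contra! hA
  rw [hasDerivWithinAt_iff_tendsto_slope' self_notMem_Ioi] at hg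
  obtain ⟨d, hd, hpos⟩ := mem_nhdsGT_iff_exists_Ioo_subset.mp (hg.eventually (lt_mem_nhds hA))
  obtain ⟨e, hxe, he⟩ := exists_between (lt_min hd hxb)
  have hed : e < d := he.trans_le (min_le_left _ _)
  have heb : e < b := he.trans_le (min_le_right _ _)
  have hmono : StrictMonoOn f (Icc x e) := by
    refine strictMonoOn_of_deriv_pos (convex_Icc x e)
      (hf.mono fun y hy => ⟨hy.1, hy.2.trans_lt heb⟩) fun y hy => ?_
    rw [interior_Icc] at hy
    rw [(hfg y ⟨hy.1, hy.2.trans heb⟩).deriv]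
    have hs : 0 < slope g x y := hpos ⟨hy.1, hy.2.trans hed⟩
    rw [slope_def_field, hgx, sub_zero] at hs
    exact (div_pos_iff_of_pos_right (sub_pos.mpr hy.1)).mp hs
  exact (hmono (left_mem_Icc.mpr hxe.le) (right_mem_Icc.mpr hxe.le) hxe).not_ge
    (hmax e ⟨hxe, heb⟩)

open Set in
/-- If `u - v` is stationary at `x` and maximal there on `[x, b)`, the right second derivatives
of `u` and `v` at `x` are ordered. -/
theorem right_second_deriv_le_of_sub_right_max {u v : ℝ → ℝ} {x b A B : ℝ} (hxb : x < b)
    (hu : DifferentiableAt ℝ u x) (hv : DifferentiableAt ℝ v x)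
    (hu' : DifferentiableOn ℝ u (Ioo x b)) (hv' : DifferentiableOn ℝ v (Ioo x b))
    (hA : HasDerivWithinAt (deriv u) A (Ioi x) x) (hB : HasDerivWithinAt (deriv v) B (Ioi x) x)
    (hd : deriv u x = deriv v x)
    (hmax : ∀ y ∈ Ioo x b, u y - v y ≤ u x - v x) : A ≤ B := by
  have hfg : ∀ y ∈ Ico x b, HasDerivAt (u - v) ((deriv u - deriv v) y) y := by
    intro y hy
    rcases hy.1.eq_or_lt with rfl | h
    · exact hu.hasDerivAt.sub hv.hasDerivAt
    · have hn := isOpen_Ioo.mem_nhds (show y ∈ Ioo x b from ⟨h, hy.2⟩)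
      exact (hu'.differentiableAt hn).hasDerivAt.sub (hv'.differentiableAt hn).hasDerivAt
  have := right_second_deriv_nonpos_of_right_max hxb
    (fun y hy => (hfg y hy).continuousAt.continuousWithinAt)
    (fun y hy => hfg y (Ioo_subset_Ico_self hy)) (by simp [hd]) (hA.sub hB) hmax
  linarith

/-- Degenerate ellipticity and monotonicity in the zeroth-order argument of the HJB operator. -/
theorem hjb_le_hjb {a b m s la ρ ind u0 v0 p u2 v2 : ℝ} (hla : 0 ≤ la) (hρ : 0 ≤ ρ)
    (hind : 0 ≤ ind) (h0 : v0 ≤ u0) (h2 : u2 ≤ v2) :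
    ((la*v0 + ρ*(v0 - 1)*ind : ℝ) : EReal)
        - ⨅ π : ℝ, (((a - b + m*π)*p + (1/2)*s^2*π^2*v2 : ℝ) : EReal)
      ≤ ((la*u0 + ρ*(u0 - 1)*ind : ℝ) : EReal)
        - ⨅ π : ℝ, (((a - b + m*π)*p + (1/2)*s^2*π^2*u2 : ℝ) : EReal) := by
  refine EReal.sub_le_sub (EReal.coe_le_coe_iff.mpr ?_)
    (iInf_mono fun π => EReal.coe_le_coe_iff.mpr ?_) <;> gcongr

open Set in
/-- A function that is nonpositive at the endpoints of `[a, b]` and nonnegative at some interior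
point attains its maximum over `[a, b]` at an interior point, with nonnegative value. -/
theorem exists_interior_max_nonneg {f : ℝ → ℝ} {a b w : ℝ} (hf : ContinuousOn f (Icc a b))
    (ha : f a ≤ 0) (hb : f b ≤ 0) (hw : w ∈ Ioo a b) (hfw : 0 ≤ f w) :
    ∃ x ∈ Ioo a b, 0 ≤ f x ∧ ∀ y ∈ Icc a b, f y ≤ f x := by
  obtain ⟨x, hx, hmax⟩ := isCompact_Icc.exists_isMaxOn ⟨w, Ioo_subset_Icc_self hw⟩ hf
  rw [isMaxOn_iff] at hmax
  by_cases h : f x ≤ 0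
  · exact ⟨w, hw, hfw, fun y hy => (hmax y hy).trans (h.trans hfw)⟩
  · refine ⟨x, ⟨hx.1.lt_of_ne ?_, hx.2.lt_of_ne ?_⟩, (not_le.mp h).le, hmax⟩
    · rintro rfl; exact h ha
    · rintro rfl; exact h hb

open Set in
theorem ContDiffOn.hasDerivWithinAt_deriv_of_mem_Ioo {u : ℝ → ℝ} {a b x : ℝ} {s : Set ℝ}
    (hu : ContDiffOn ℝ 2 u (Ioo a b)) (hx : x ∈ Ioo a b) :
    HasDerivWithinAt (deriv u) (deriv (deriv u) x) s x :=
  (((hu.deriv_of_isOpen isOpen_Ioo (m := 1) (by norm_num)).differentiableOn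
    one_ne_zero).differentiableAt (isOpen_Ioo.mem_nhds hx)).hasDerivAt.hasDerivWithinAt


/-- Comparison lemma for strict sub- and super-solutions of the HJB operator F. -/
theorem stmt_17 (r μ σ la ρ c L : ℝ)
    (hr : 0 < r) (hμ : r < μ) (hσ : 0 < σ) (hla : 0 < la) (hρ : 0 < ρ)
    (hc : 0 < c) (hL : 0 < L)
    (δ : ℝ) (hδ : δ = (1/2) * ((μ - r)/σ)^2)
    -- the operator F, with the value `ind` of the indicator 1_{w<0} as first argument
    (F : ℝ → ℝ → ℝ → ℝ → ℝ → EReal)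
    (hF : ∀ ind w u0 u1 u2 : ℝ, F ind w u0 u1 u2 =
      ((la*u0 + ρ*(u0 - 1)*ind : ℝ) : EReal)
        - ⨅ π : ℝ, (((r*w - c + (μ - r)*π)*u1 + (1/2)*σ^2*π^2*u2 : ℝ) : EReal))
    -- u, v belong to the class 𝒞, with one-sided second derivatives u2m, u2p, v2m, v2p at 0
    (u v : ℝ → ℝ) (u2m u2p v2m v2p : ℝ)
    (huC : ContinuousOn u (Set.Icc (-L) (c/r)) ∧
      ContDiffOn ℝ 2 u (Set.Ioo (-L) 0) ∧ ContDiffOn ℝ 2 u (Set.Ioo 0 (c/r)) ∧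
      DifferentiableAt ℝ u 0 ∧
      HasDerivWithinAt (deriv u) u2m (Set.Iio 0) 0 ∧
      HasDerivWithinAt (deriv u) u2p (Set.Ioi 0) 0)
    (hvC : ContinuousOn v (Set.Icc (-L) (c/r)) ∧
      ContDiffOn ℝ 2 v (Set.Ioo (-L) 0) ∧ ContDiffOn ℝ 2 v (Set.Ioo 0 (c/r)) ∧
      DifferentiableAt ℝ v 0 ∧
      HasDerivWithinAt (deriv v) v2m (Set.Iio 0) 0 ∧
      HasDerivWithinAt (deriv v) v2p (Set.Ioi 0) 0)
    -- (i) strict sub/super-solution comparison away from 0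
    (hsubneg : ∀ w ∈ Set.Ioo (-L) 0,
      F 1 w (u w) (deriv u w) (deriv (deriv u) w)
        < F 1 w (v w) (deriv v w) (deriv (deriv v) w))
    (hsubpos : ∀ w ∈ Set.Ioo 0 (c/r),
      F 0 w (u w) (deriv u w) (deriv (deriv u) w)
        < F 0 w (v w) (deriv v w) (deriv (deriv v) w))
    -- (ii) both one-sided versions at w = 0
    (hzerom : F 1 0 (u 0) (deriv u 0) u2m < F 1 0 (v 0) (deriv v 0) v2m)
    (hzerop : F 0 0 (u 0) (deriv u 0) u2p < F 0 0 (v 0) (deriv v 0) v2p)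
    -- (iii) boundary comparison
    (hbdryL : u (-L) ≤ v (-L)) (hbdryR : u (c/r) ≤ v (c/r)) :
    ∀ w ∈ Set.Ioo (-L) (c/r), u w < v w := by
  intro w hw
  by_contra! hle
  obtain ⟨huc, hun, hup, hu0, -, hu2p⟩ := huC
  obtain ⟨hvc, hvn, hvp, hv0, -, hv2p⟩ := hvC
  obtain ⟨x, hx, hfx, hmax⟩ := exists_interior_max_nonneg (huc.sub hvc)
    (sub_nonpos.mpr hbdryL) (sub_nonpos.mpr hbdryR) hw (sub_nonneg.mpr hle)
  have hvu : v x ≤ u x := sub_nonneg.mp hfx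
  have hderiv (hu : DifferentiableAt ℝ u x) (hv : DifferentiableAt ℝ v x) :
      deriv u x = deriv v x := by
    have hloc : IsLocalMax (u - v) x :=
      Filter.mem_of_superset (Icc_mem_nhds hx.1 hx.2) hmax
    exact sub_eq_zero.mp (hloc.hasDerivAt_eq_zero (hu.hasDerivAt.sub hv.hasDerivAt))
  have key (ind b A B : ℝ) (hind : 0 ≤ ind) (hxb : x < b) (hb : b ≤ c/r)
      (hu : DifferentiableAt ℝ u x) (hv : DifferentiableAt ℝ v x)
      (hu' : DifferentiableOn ℝ u (Set.Ioo x b)) (hv' : DifferentiableOn ℝ v (Set.Ioo x b))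
      (hA : HasDerivWithinAt (deriv u) A (Set.Ioi x) x)
      (hB : HasDerivWithinAt (deriv v) B (Set.Ioi x) x) :
      F ind x (v x) (deriv v x) B ≤ F ind x (u x) (deriv u x) A := by
    have hAB := right_second_deriv_le_of_sub_right_max hxb hu hv hu' hv' hA hB (hderiv hu hv)
      fun y hy => hmax y ⟨(hx.1.trans hy.1).le, hy.2.le.trans hb⟩
    rw [hF, hF, hderiv hu hv]
    exact hjb_le_hjb hla.le hρ.le hind hvu hAB
  have smooth (ind a b : ℝ) (hind : 0 ≤ ind) (hxab : x ∈ Set.Ioo a b) (hb : b ≤ c/r)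
      (hu : ContDiffOn ℝ 2 u (Set.Ioo a b)) (hv : ContDiffOn ℝ 2 v (Set.Ioo a b)) :
      F ind x (v x) (deriv v x) (deriv (deriv v) x)
        ≤ F ind x (u x) (deriv u x) (deriv (deriv u) x) := by
    have hn := isOpen_Ioo.mem_nhds hxab
    have hsub := Set.Ioo_subset_Ioo_left (b := b) hxab.1.le
    have hud := hu.differentiableOn two_ne_zero
    have hvd := hv.differentiableOn two_ne_zero
    exact key ind b _ _ hind hxab.2 hb (hud.differentiableAt hn) (hvd.differentiableAt hn)
      (hud.mono hsub) (hvd.mono hsub)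
      (hu.hasDerivWithinAt_deriv_of_mem_Ioo hxab) (hv.hasDerivWithinAt_deriv_of_mem_Ioo hxab)
  have hcr : 0 < c/r := div_pos hc hr
  rcases lt_trichotomy x 0 with h | rfl | h
  · exact (hsubneg x ⟨hx.1, h⟩).not_ge (smooth 1 _ _ zero_le_one ⟨hx.1, h⟩ hcr.le hun hvn)
  · exact hzerop.not_ge (key 0 _ _ _ le_rfl hcr le_rfl hu0 hv0
      (hup.differentiableOn two_ne_zero) (hvp.differentiableOn two_ne_zero) hu2p hv2p)
  · exact (hsubpos x ⟨h, hx.2⟩).not_ge (smooth 0 _ _ le_rfl ⟨h, hx.2⟩ le_rfl hup hvp)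
end

section
/- Let w ∈ [−L, c/r] and let m0, m1, m2 be real numbers with m2 > 0 satisfying λ·m0 = 1_{w<0} + (r·w − c)·m1 − δ·m1²/m2. Then for every ρ > 0: (i) the infimum over π ∈ ℝ of (r·w − c + (μ−r)·π)·(ρ·m1) + (1/2)·σ²·π²·(ρ·m2) equals the real number (r·w − c)·ρ·m1 − δ·ρ·m1²/m2; and (ii) F(w, ρ·m0, ρ·m1, ρ·m2) = ρ²·m0·1_{w<0}. In particular, if in addition 0 ≤ m0 ≤ 1/λ, then 0 ≤ F(w, ρ·m0, ρ·m1, ρ·m2) ≤ ρ²/λ. -/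
/-- The minimum over `x` of the quadratic `(b + k * x) * p + s ^ 2 * x ^ 2 * q / 2` with `q > 0`,
attained at `x = -(k * p) / (s ^ 2 * q)`. -/
lemma iInf_quadratic_coe_ereal (b k p : ℝ) {s q : ℝ} (hs : s ≠ 0) (hq : 0 < q) :
    (⨅ x : ℝ, (((b + k * x) * p + (1/2) * s^2 * x^2 * q : ℝ) : EReal)) =
      ((b * p - (1/2) * (k/s)^2 * p^2 / q : ℝ) : EReal) := by
  have hq' := hq.ne'
  apply le_antisymm
  · refine (iInf_le _ (-(k * p) / (s^2 * q))).trans (le_of_eq ?_)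
    congr 1
    field_simp
    ring
  · refine le_iInf fun x => EReal.coe_le_coe_iff.2 ?_
    have key : (b + k * x) * p + (1/2) * s^2 * x^2 * q - (b * p - (1/2) * (k/s)^2 * p^2 / q) =
        (1/2) * q * (s * x + k * p / (s * q))^2 := by
      field_simp
      ring
    have : 0 ≤ (1/2) * q * (s * x + k * p / (s * q))^2 := by positivity
    linarith

/-- Evaluation of the operator F along ρ·m when m solves the occupation-time HJB
equation: F(w, ρm, ρm', ρm'') = ρ²·m·1_{w<0}, and the resulting bounds. -/
theorem stmt_18 (r μ σ la c L : ℝ)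
    (hr : 0 < r) (hμ : r < μ) (hσ : 0 < σ) (hla : 0 < la) (hc : 0 < c) (hL : 0 < L)
    (δ : ℝ) (hδ : δ = (1/2) * ((μ - r)/σ)^2)
    -- the operator F, with the parameter ρ as first argument
    (F : ℝ → ℝ → ℝ → ℝ → ℝ → EReal)
    (hF : ∀ ρ w u0 u1 u2 : ℝ, F ρ w u0 u1 u2 =
      ((la*u0 + ρ*(u0 - 1)*(if w < 0 then (1:ℝ) else 0) : ℝ) : EReal)
        - ⨅ π : ℝ, (((r*w - c + (μ - r)*π)*u1 + (1/2)*σ^2*π^2*u2 : ℝ) : EReal))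
    (w : ℝ) (hw : w ∈ Set.Icc (-L) (c/r))
    (m0 m1 m2 : ℝ) (hm2 : 0 < m2)
    (hm : la * m0 = (if w < 0 then (1:ℝ) else 0) + (r*w - c) * m1 - δ * m1^2 / m2) :
    ∀ ρ : ℝ, 0 < ρ →
      ((⨅ π : ℝ, (((r*w - c + (μ - r)*π)*(ρ*m1)
            + (1/2)*σ^2*π^2*(ρ*m2) : ℝ) : EReal))
          = (((r*w - c)*(ρ*m1) - δ*ρ*m1^2/m2 : ℝ) : EReal)) ∧
      F ρ w (ρ*m0) (ρ*m1) (ρ*m2)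
        = ((ρ^2 * m0 * (if w < 0 then (1:ℝ) else 0) : ℝ) : EReal) ∧
      (0 ≤ m0 → m0 ≤ 1/la →
        (0 : EReal) ≤ F ρ w (ρ*m0) (ρ*m1) (ρ*m2) ∧
          F ρ w (ρ*m0) (ρ*m1) (ρ*m2) ≤ ((ρ^2/la : ℝ) : EReal)) := by
  intro ρ hρ
  have hInf : (⨅ π : ℝ, (((r*w - c + (μ - r)*π)*(ρ*m1)
      + (1/2)*σ^2*π^2*(ρ*m2) : ℝ) : EReal)) =
      (((r*w - c)*(ρ*m1) - δ*ρ*m1^2/m2 : ℝ) : EReal) := by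
    rw [iInf_quadratic_coe_ereal _ _ _ hσ.ne' (mul_pos hρ hm2), hδ]
    congr 1
    field_simp
  have hFval : F ρ w (ρ*m0) (ρ*m1) (ρ*m2) =
      ((ρ^2 * m0 * (if w < 0 then (1:ℝ) else 0) : ℝ) : EReal) := by
    rw [hF, hInf, ← EReal.coe_sub]
    congr 1
    linear_combination ρ * hm
  refine ⟨hInf, hFval, fun h0 h1 => ?_⟩
  rw [hFval, ← EReal.coe_zero, EReal.coe_le_coe_iff, EReal.coe_le_coe_iff]
  have hle : ρ^2 * m0 ≤ ρ^2 / la := by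
    simpa [div_eq_mul_inv] using mul_le_mul_of_nonneg_left h1 (sq_nonneg ρ)
  split_ifs
  · rw [mul_one]
    exact ⟨by positivity, hle⟩
  · rw [mul_zero]
    exact ⟨le_rfl, by positivity⟩
end

section
/- Suppose m ∈ 𝒞 satisfies: m''(w) > 0 for all w ∈ (−L, 0) ∪ (0, c/r) and m''(0−) > 0, m''(0+) > 0; 0 ≤ m(w) ≤ 1/λ for all w ∈ [−L, c/r]; m(−L) = 1/λ and m(c/r) = 0; and λ·m(w) = 1_{w<0} + (r·w − c)·m'(w) − δ·m'(w)²/m''(w) for all w ∈ (−L, 0) ∪ (0, c/r), with the equation also holding at w = 0 for both one-sided second derivatives (with indicator value 1 for the left version and 0 for the right version). Suppose ψ ∈ 𝒞 satisfies F(w, ψ(w), ψ'(w), ψ''(w)) = 0 for all w ∈ (−L, 0) ∪ (0, c/r) (and at w = 0 for both one-sided second derivatives, with the corresponding indicator values), together with ψ(−L) = ρ/(λ+ρ) and ψ(c/r) = 0. Then ρ·m(w) − (ρ/λ)² < ψ(w) < ρ·m(w) for all w ∈ [−L, c/r); in particular ψ(w) = ρ·m(w) + O(ρ²) as ρ → 0,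 uniformly in w. -/
open Set Filter Topology

/-- `f` is differentiable on a left neighbourhood of `w` (including `w`), and `deriv f` has left
derivative `d` at `w`. -/
def HasLeftDeriv2At (f : ℝ → ℝ) (d w : ℝ) : Prop :=
  (∀ᶠ x in 𝓝[≤] w, DifferentiableAt ℝ f x) ∧ HasDerivWithinAt (deriv f) d (Iio w) w

lemma HasLeftDeriv2At.const_mul {f : ℝ → ℝ} {d w : ℝ} (h : HasLeftDeriv2At f d w) (k : ℝ) :
    HasLeftDeriv2At (fun x => k * f x) (k * d) w := by
  refine ⟨h.1.mono fun x hx => hx.const_mul k, ?_⟩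
  have : deriv (fun x => k * f x) = fun x => k * deriv f x := by
    funext x; exact deriv_const_mul_field k
  rw [this]
  exact h.2.const_mul k

lemma hasLeftDeriv2At_of_contDiffOn {f : ℝ → ℝ} {a b w : ℝ} (hf : ContDiffOn ℝ 2 f (Ioo a b))
    (hw : w ∈ Ioo a b) : HasLeftDeriv2At f (deriv (deriv f) w) w := by
  have hd : DifferentiableOn ℝ f (Ioo a b) := hf.differentiableOn (by norm_num)
  refine ⟨?_, ?_⟩
  · have : ∀ᶠ x in 𝓝 w, DifferentiableAt ℝ f x := by
      filter_upwards [isOpen_Ioo.mem_nhds hw] with x hx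
      exact hd.differentiableAt (isOpen_Ioo.mem_nhds hx)
    exact this.filter_mono nhdsWithin_le_nhds
  · have h1 : ContDiffOn ℝ 1 (deriv f) (Ioo a b) :=
      hf.deriv_of_isOpen isOpen_Ioo (by norm_num)
    exact (((h1.differentiableOn (by norm_num)).differentiableAt
      (isOpen_Ioo.mem_nhds hw)).hasDerivAt).hasDerivWithinAt

lemma hasLeftDeriv2At_of_left {f : ℝ → ℝ} {a d w : ℝ} (haw : a < w)
    (hf : ContDiffOn ℝ 2 f (Ioo a w)) (h0 : DifferentiableAt ℝ f w)
    (hd : HasDerivWithinAt (deriv f) d (Iio w) w) : HasLeftDeriv2At f d w := by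
  refine ⟨?_, hd⟩
  filter_upwards [Ioc_mem_nhdsLE haw] with x hx
  rcases hx.2.eq_or_lt with rfl | h
  · exact h0
  · exact (hf.differentiableOn (by norm_num)).differentiableAt (isOpen_Ioo.mem_nhds ⟨hx.1, h⟩)

/-- One-sided second derivative test at a local maximum of `f - g`. -/
lemma HasLeftDeriv2At.deriv_eq_and_le {f g : ℝ → ℝ} {f2 g2 w : ℝ}
    (hf : HasLeftDeriv2At f f2 w) (hg : HasLeftDeriv2At g g2 w)
    (hmax : IsLocalMax (fun x => f x - g x) w) :
    deriv f w = deriv g w ∧ f2 ≤ g2 := by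
  have hfw := hf.1.self_of_nhdsWithin self_mem_Iic
  have hgw := hg.1.self_of_nhdsWithin self_mem_Iic
  have h1 : deriv f w = deriv g w := by
    have := hmax.deriv_eq_zero
    rw [deriv_fun_sub hfw hgw] at this
    linarith
  refine ⟨h1, ?_⟩
  by_contra! hlt
  have hs : HasDerivWithinAt (fun x => deriv f x - deriv g x) (f2 - g2) (Iio w) w :=
    hf.2.sub hg.2
  have hneg : ∀ᶠ x in 𝓝[<] w, deriv f x - deriv g x < 0 := by
    have ht := hasDerivWithinAt_iff_tendsto_slope.1 hs
    have hset : Iio w \ {w} = Iio w := by simp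
    rw [hset] at ht
    filter_upwards [ht.eventually_const_lt (sub_pos.2 hlt), self_mem_nhdsWithin] with x hx hxw
    rw [slope_def_field, h1, sub_self, sub_zero] at hx
    have hxw' : x - w < 0 := sub_neg.2 hxw
    by_contra! hge
    exact absurd hx (not_lt.2 (div_nonpos_of_nonneg_of_nonpos hge hxw'.le))
  have hall : ∀ᶠ x in 𝓝[<] w, DifferentiableAt ℝ f x ∧ DifferentiableAt ℝ g x ∧
      deriv f x - deriv g x < 0 ∧ f x - g x ≤ f w - g w := by
    have hle : 𝓝[<] w ≤ 𝓝[≤] w := nhdsWithin_mono _ Iio_subset_Iic_self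
    filter_upwards [hf.1.filter_mono hle, hg.1.filter_mono hle, hneg,
      hmax.filter_mono nhdsWithin_le_nhds] with x a b c d
    exact ⟨a, b, c, d⟩
  obtain ⟨a, haw, ha⟩ := mem_nhdsLT_iff_exists_Ioo_subset.1 hall
  have haw : a < w := haw
  obtain ⟨y, hay, hyw⟩ := exists_between haw
  have hanti : StrictAntiOn (fun x => f x - g x) (Icc y w) := by
    refine strictAntiOn_of_deriv_neg (convex_Icc _ _) ?_ ?_
    · intro x hx
      apply ContinuousAt.continuousWithinAt
      rcases hx.2.eq_or_lt with rfl | h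
      · exact hfw.continuousAt.sub hgw.continuousAt
      · have := ha ⟨hay.trans_le hx.1, h⟩
        exact this.1.continuousAt.sub this.2.1.continuousAt
    · intro x hx
      rw [interior_Icc] at hx
      have := ha ⟨hay.trans hx.1, hx.2⟩
      rw [deriv_fun_sub this.1 this.2.1]
      exact this.2.2.1
  have h2 := hanti (left_mem_Icc.2 hyw.le) (right_mem_Icc.2 hyw.le) hyw
  have h3 := (ha ⟨hay, hyw⟩).2.2.2
  simp only at h2
  linarith

lemma eq_coe_of_coe_sub_eq_zero {A : ℝ} {I : EReal} (h : (A : EReal) - I = 0) : I = A := by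
  induction I with
  | bot => simp at h
  | top => simp at h
  | coe x =>
    norm_cast at h ⊢
    linarith

lemma le_quadratic {b s p q π : ℝ} (hs : 0 < s) (hq : 0 < q) :
    -((1/2) * (b/s)^2) * p^2 / q ≤ b * π * p + (1/2) * s^2 * π^2 * q := by
  have : b * π * p + (1/2) * s^2 * π^2 * q - -((1/2) * (b/s)^2) * p^2 / q
      = (1/2) * (s * π * q + b / s * p)^2 / q := by
    field_simp
    ring
  have h2 : 0 ≤ (1/2) * (s * π * q + b / s * p)^2 / q := by positivity
  linarith

lemma quadratic_at_minimizer {b s p q : ℝ} (hs : 0 < s) (hq : 0 < q) :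
    b * (-(b * p) / (s^2 * q)) * p + (1/2) * s^2 * (-(b * p) / (s^2 * q))^2 * q
      = -((1/2) * (b/s)^2) * p^2 / q := by
  field_simp
  ring


/-- The minimum probability of lifetime exponential Parisian ruin ψ satisfies
ρ·m(w) − (ρ/λ)² < ψ(w) < ρ·m(w) on [−L, c/r), where m is the minimum expected
occupation time; hence ψ = ρ·m + O(ρ²) uniformly as ρ → 0. -/
theorem stmt_19 (r μ σ la ρ c L : ℝ)
    (hr : 0 < r) (hμ : r < μ) (hσ : 0 < σ) (hla : 0 < la) (hρ : 0 < ρ)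
    (hc : 0 < c) (hL : 0 < L)
    (δ : ℝ) (hδ : δ = (1/2) * ((μ - r)/σ)^2)
    -- the operator F, with the value `ind` of the indicator 1_{w<0} as first argument
    (F : ℝ → ℝ → ℝ → ℝ → ℝ → EReal)
    (hF : ∀ ind w u0 u1 u2 : ℝ, F ind w u0 u1 u2 =
      ((la*u0 + ρ*(u0 - 1)*ind : ℝ) : EReal)
        - ⨅ π : ℝ, (((r*w - c + (μ - r)*π)*u1 + (1/2)*σ^2*π^2*u2 : ℝ) : EReal))
    -- m belongs to the class 𝒞, with one-sided second derivatives m2m, m2p at 0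
    (m : ℝ → ℝ) (m2m m2p : ℝ)
    (hmC : ContinuousOn m (Set.Icc (-L) (c/r)) ∧
      ContDiffOn ℝ 2 m (Set.Ioo (-L) 0) ∧ ContDiffOn ℝ 2 m (Set.Ioo 0 (c/r)) ∧
      DifferentiableAt ℝ m 0 ∧
      HasDerivWithinAt (deriv m) m2m (Set.Iio 0) 0 ∧
      HasDerivWithinAt (deriv m) m2p (Set.Ioi 0) 0)
    (hmconv : ∀ w ∈ Set.Ioo (-L) 0 ∪ Set.Ioo 0 (c/r), 0 < deriv (deriv m) w)
    (hm2m : 0 < m2m) (hm2p : 0 < m2p)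
    (hmbd : ∀ w ∈ Set.Icc (-L) (c/r), 0 ≤ m w ∧ m w ≤ 1/la)
    (hmL : m (-L) = 1/la) (hmR : m (c/r) = 0)
    (hmODEneg : ∀ w ∈ Set.Ioo (-L) 0,
      la * m w = 1 + (r*w - c) * deriv m w - δ * (deriv m w)^2 / deriv (deriv m) w)
    (hmODEpos : ∀ w ∈ Set.Ioo 0 (c/r),
      la * m w = 0 + (r*w - c) * deriv m w - δ * (deriv m w)^2 / deriv (deriv m) w)
    (hmODE0m : la * m 0 = 1 + (r*0 - c) * deriv m 0 - δ * (deriv m 0)^2 / m2m)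
    (hmODE0p : la * m 0 = 0 + (r*0 - c) * deriv m 0 - δ * (deriv m 0)^2 / m2p)
    -- ψ belongs to the class 𝒞, with one-sided second derivatives ψ2m, ψ2p at 0
    (ψ : ℝ → ℝ) (ψ2m ψ2p : ℝ)
    (hψC : ContinuousOn ψ (Set.Icc (-L) (c/r)) ∧
      ContDiffOn ℝ 2 ψ (Set.Ioo (-L) 0) ∧ ContDiffOn ℝ 2 ψ (Set.Ioo 0 (c/r)) ∧
      DifferentiableAt ℝ ψ 0 ∧
      HasDerivWithinAt (deriv ψ) ψ2m (Set.Iio 0) 0 ∧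
      HasDerivWithinAt (deriv ψ) ψ2p (Set.Ioi 0) 0)
    (hψFneg : ∀ w ∈ Set.Ioo (-L) 0,
      F 1 w (ψ w) (deriv ψ w) (deriv (deriv ψ) w) = 0)
    (hψFpos : ∀ w ∈ Set.Ioo 0 (c/r),
      F 0 w (ψ w) (deriv ψ w) (deriv (deriv ψ) w) = 0)
    (hψF0m : F 1 0 (ψ 0) (deriv ψ 0) ψ2m = 0)
    (hψF0p : F 0 0 (ψ 0) (deriv ψ 0) ψ2p = 0)
    (hψL : ψ (-L) = ρ/(la + ρ)) (hψR : ψ (c/r) = 0) :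
    ∀ w ∈ Set.Ico (-L) (c/r),
      ρ * m w - (ρ/la)^2 < ψ w ∧ ψ w < ρ * m w := by
  subst hδ
  obtain ⟨hmc, hmneg, hmpos, hm0, hmd0, -⟩ := hmC
  obtain ⟨hψc, hψneg, hψpos, hψ0, hψd0, -⟩ := hψC
  have hR : 0 < c / r := by positivity
  have hL0 : -L < 0 := by linarith
  have data : ∀ w ∈ Ioo (-L) (c/r), ∃ i m2 ψ2 : ℝ, (0 < w ∧ i = 0 ∨ w ≤ 0 ∧ i = 1) ∧ 0 < m2 ∧
      HasLeftDeriv2At m m2 w ∧ HasLeftDeriv2At ψ ψ2 w ∧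
      la * m w = i + (r*w - c) * deriv m w - (1/2) * ((μ - r)/σ)^2 * (deriv m w)^2 / m2 ∧
      F i w (ψ w) (deriv ψ w) ψ2 = 0 := by
    intro w hw
    rcases lt_trichotomy w 0 with h | rfl | h
    · have hw' : w ∈ Ioo (-L) 0 := ⟨hw.1, h⟩
      exact ⟨1, _, _, .inr ⟨h.le, rfl⟩, hmconv w (.inl hw'),
        hasLeftDeriv2At_of_contDiffOn hmneg hw', hasLeftDeriv2At_of_contDiffOn hψneg hw',
        hmODEneg w hw', hψFneg w hw'⟩
    · exact ⟨1, _, _, .inr ⟨le_rfl, rfl⟩, hm2m, hasLeftDeriv2At_of_left hL0 hmneg hm0 hmd0,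
        hasLeftDeriv2At_of_left hL0 hψneg hψ0 hψd0, hmODE0m, hψF0m⟩
    · have hw' : w ∈ Ioo 0 (c/r) := ⟨h, hw.2⟩
      exact ⟨0, _, _, .inl ⟨h, rfl⟩, hmconv w (.inr hw'),
        hasLeftDeriv2At_of_contDiffOn hmpos hw', hasLeftDeriv2At_of_contDiffOn hψpos hw',
        hmODEpos w hw', hψFpos w hw'⟩
  have upper : ∀ k, 0 < k → ∀ w ∈ Ioo (-L) (c/r), IsLocalMax (fun x => ψ x - k * m x) w →
      ∃ i : ℝ, (0 < w ∧ i = 0 ∨ w ≤ 0 ∧ i = 1) ∧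
        la * ψ w + ρ * (ψ w - 1) * i ≤ k * (la * m w - i) := by
    intro k hk w hw hmax
    obtain ⟨i, m2, ψ2, hi, hm2, hmw, hψw, hode, hFw⟩ := data w hw
    refine ⟨i, hi, ?_⟩
    obtain ⟨h1, h2⟩ := hψw.deriv_eq_and_le (hmw.const_mul k) hmax
    rw [deriv_const_mul_field k] at h1
    rw [hF] at hFw
    have hI := eq_coe_of_coe_sub_eq_zero hFw
    have hle := iInf_le (fun π : ℝ => (((r*w - c + (μ - r)*π)*deriv ψ w
      + (1/2)*σ^2*π^2*ψ2 : ℝ) : EReal)) (-((μ - r) * deriv m w) / (σ^2 * m2))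
    rw [hI, EReal.coe_le_coe_iff] at hle
    have hq := quadratic_at_minimizer (b := μ - r) (p := deriv m w) hσ hm2
    set π := -((μ - r) * deriv m w) / (σ^2 * m2)
    have h3 : (1/2)*σ^2*π^2*ψ2 ≤ (1/2)*σ^2*π^2*(k * m2) :=
      mul_le_mul_of_nonneg_left h2 (by positivity)
    rw [h1] at hle
    have h4 : k * (la * m w - i) = k * ((r*w - c) * deriv m w
        + ((μ - r) * π * deriv m w + (1/2)*σ^2*π^2*m2)) := by
      rw [hq, hode]; ring
    rw [h4]
    linarith
  have lower : ∀ w ∈ Ioo (-L) (c/r), IsLocalMax (fun x => ρ * m x - ψ x) w →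
      ∃ i : ℝ, (0 < w ∧ i = 0 ∨ w ≤ 0 ∧ i = 1) ∧
        ρ * (la * m w - i) ≤ la * ψ w + ρ * (ψ w - 1) * i := by
    intro w hw hmax
    obtain ⟨i, m2, ψ2, hi, hm2, hmw, hψw, hode, hFw⟩ := data w hw
    refine ⟨i, hi, ?_⟩
    obtain ⟨h1, h2⟩ := (hmw.const_mul ρ).deriv_eq_and_le hψw hmax
    rw [deriv_const_mul_field ρ] at h1
    rw [hF] at hFw
    rw [← EReal.coe_le_coe_iff, ← eq_coe_of_coe_sub_eq_zero hFw]
    refine le_iInf fun π => ?_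
    rw [EReal.coe_le_coe_iff, ← h1]
    have hq := le_quadratic (b := μ - r) (p := deriv m w) (π := π) hσ hm2
    have h3 : (1/2)*σ^2*π^2*(ρ * m2) ≤ (1/2)*σ^2*π^2*ψ2 :=
      mul_le_mul_of_nonneg_left h2 (by positivity)
    have h4 : la * m w - i ≤ (r*w - c) * deriv m w
        + ((μ - r) * π * deriv m w + (1/2)*σ^2*π^2*m2) := by
      rw [hode]
      have : -(1/2 * ((μ - r)/σ)^2) * (deriv m w)^2 / m2
        = -(1/2 * ((μ - r)/σ)^2 * (deriv m w)^2 / m2) := by ring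
      linarith
    have h5 := mul_le_mul_of_nonneg_left h4 hρ.le
    linarith
  have hmconvR : StrictConvexOn ℝ (Icc 0 (c/r)) m := by
    refine strictConvexOn_of_deriv2_pos (convex_Icc _ _)
      (hmc.mono (Icc_subset_Icc_left hL0.le)) fun x hx => ?_
    rw [interior_Icc] at hx
    exact hmconv x (.inr hx)
  have hmpos' : ∀ w ∈ Ioo (-L) (c/r), 0 < m w := by
    intro w hw
    refine lt_of_le_of_ne (hmbd w (Ioo_subset_Icc_self hw)).1 fun h => ?_
    rcases lt_or_ge w 0 with hw0 | hw0
    · have hmin : IsLocalMin m w := by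
        filter_upwards [isOpen_Ioo.mem_nhds hw] with x hx
        rw [← h]
        exact (hmbd x (Ioo_subset_Icc_self hx)).1
      have hode := hmODEneg w ⟨hw.1, hw0⟩
      rw [← h, hmin.deriv_eq_zero] at hode
      norm_num at hode
    · have hlt := hmconvR.2 ⟨hw0, hw.2.le⟩ (right_mem_Icc.2 hR.le) hw.2.ne
        (by norm_num : (0 : ℝ) < 1/2) (by norm_num : (0 : ℝ) < 1/2) (by norm_num)
      rw [← h, hmR] at hlt
      simp only [smul_eq_mul] at hlt
      have hge := (hmbd (1/2 * w + 1/2 * (c/r)) ⟨by linarith [hw.1], by linarith [hw.2]⟩).1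
      linarith
  have hcont : ∀ k, ContinuousOn (fun x => ψ x - k * m x) (Icc (-L) (c/r)) := fun k =>
    hψc.sub (continuousOn_const.mul hmc)
  have hψ_lt_left : ρ / (la + ρ) < ρ / la := by
    apply div_lt_div_of_pos_left <;> linarith
  have weak : ∀ w ∈ Icc (-L) (c/r), ψ w ≤ ρ * m w := by
    obtain ⟨w₀, hw₀, hmax⟩ := isCompact_Icc.exists_isMaxOn
      (nonempty_Icc.2 (hL0.trans hR).le) (hcont ρ)
    suffices ψ w₀ ≤ ρ * m w₀ by
      intro w hw
      have := hmax hw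
      simp only [mem_ofPred_eq] at this
      linarith
    rcases hw₀.1.eq_or_lt with rfl | h1
    · rw [hψL, hmL, mul_one_div]; exact hψ_lt_left.le
    rcases hw₀.2.eq_or_lt with rfl | h2
    · rw [hψR, hmR, mul_zero]
    obtain ⟨i, hi, h⟩ := upper ρ hρ w₀ ⟨h1, h2⟩ (hmax.isLocalMax (Icc_mem_nhds h1 h2))
    have hm' := (hmpos' w₀ ⟨h1, h2⟩).le
    rcases hi with ⟨-, rfl⟩ | ⟨-, rfl⟩
    · nlinarith
    · by_contra! hlt
      nlinarith [mul_pos hla (sub_pos.2 hlt), mul_pos hρ (sub_pos.2 hlt),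
        mul_nonneg hρ.le (mul_nonneg hρ.le hm')]
  have strict_left : ∀ w ∈ Ioc (-L) 0, ψ w < ρ * m w := by
    intro w hw
    have hw' : w ∈ Ioo (-L) (c/r) := ⟨hw.1, hw.2.trans_lt hR⟩
    refine lt_of_le_of_ne (weak w (Ioo_subset_Icc_self hw')) fun heq => ?_
    have hmax : IsLocalMax (fun x => ψ x - ρ * m x) w := by
      filter_upwards [isOpen_Ioo.mem_nhds hw'] with x hx
      have := weak x (Ioo_subset_Icc_self hx)
      linarith
    obtain ⟨i, hi, h⟩ := upper ρ hρ w hw' hmax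
    have hm' := hmpos' w hw'
    rcases hi with ⟨h0, -⟩ | ⟨-, rfl⟩
    · exact absurd hw.2 (not_le.2 h0)
    · rw [heq] at h
      nlinarith [mul_pos hρ (mul_pos hρ hm')]
  have strict_right : ∀ w ∈ Ioo 0 (c/r), ψ w < ρ * m w := by
    have hm00 := hmpos' 0 ⟨hL0, hR⟩
    -- the equation is homogeneous on the right of zero, so compare with a smaller multiple of `m`
    obtain ⟨k, hk, hkρ, hk0⟩ : ∃ k, 0 < k ∧ k < ρ ∧ ψ 0 ≤ k * m 0 := by
      refine ⟨max (ψ 0 / m 0) (ρ/2), lt_max_of_lt_right (by linarith), max_lt ?_ (by linarith), ?_⟩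
      · rw [div_lt_iff₀ hm00]
        exact strict_left 0 ⟨hL0, le_rfl⟩
      · rw [← div_le_iff₀ hm00]
        exact le_max_left _ _
    obtain ⟨w₀, hw₀, hmax⟩ := isCompact_Icc.exists_isMaxOn (nonempty_Icc.2 hR.le)
      ((hcont k).mono (Icc_subset_Icc_left hL0.le))
    have hle : ψ w₀ ≤ k * m w₀ := by
      rcases hw₀.1.eq_or_lt with rfl | h1
      · exact hk0
      rcases hw₀.2.eq_or_lt with rfl | h2
      · rw [hψR, hmR, mul_zero]
      obtain ⟨i, hi, h⟩ := upper k hk w₀ ⟨hL0.trans h1, h2⟩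
        (hmax.isLocalMax (Icc_mem_nhds h1 h2))
      rcases hi with ⟨-, rfl⟩ | ⟨h0, -⟩
      · nlinarith
      · exact absurd h1 (not_lt.2 h0)
    intro w hw
    have h1 := hmax (Ioo_subset_Icc_self hw)
    simp only [mem_ofPred_eq] at h1
    have h2 := mul_lt_mul_of_pos_right hkρ (hmpos' w ⟨hL0.trans hw.1, hw.2⟩)
    linarith
  have hgap : ∀ w ∈ Icc (-L) (c/r), ρ * m w - (ρ/la)^2 < ψ w := by
    have hc' : ContinuousOn (fun x => ρ * m x - ψ x) (Icc (-L) (c/r)) :=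
      (continuousOn_const.mul hmc).sub hψc
    obtain ⟨w₀, hw₀, hmax⟩ := isCompact_Icc.exists_isMaxOn
      (nonempty_Icc.2 (hL0.trans hR).le) hc'
    suffices ρ * m w₀ - (ρ/la)^2 < ψ w₀ by
      intro w hw
      have := hmax hw
      simp only [mem_ofPred_eq] at this
      linarith
    have hsq : 0 < (ρ/la)^2 := by positivity
    rcases hw₀.1.eq_or_lt with rfl | h1
    · rw [hψL, hmL, ← sub_pos]
      have : ρ / (la + ρ) - (ρ * (1 / la) - (ρ / la)^2) = ρ^3 / (la^2 * (la + ρ)) := by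
        field_simp
        ring
      rw [this]
      positivity
    rcases hw₀.2.eq_or_lt with rfl | h2
    · rw [hψR, hmR]; linarith
    obtain ⟨i, hi, h⟩ := lower w₀ ⟨h1, h2⟩ (hmax.isLocalMax (Icc_mem_nhds h1 h2))
    rcases hi with ⟨-, rfl⟩ | ⟨-, rfl⟩
    · nlinarith
    · have hm1 := (hmbd w₀ hw₀).2
      have hla1 : la * m w₀ ≤ 1 := by
        rw [le_div_iff₀ hla] at hm1; linarith
      obtain ⟨t, ht⟩ : ∃ t, t = ρ / la := ⟨_, rfl⟩
      have hρt : ρ = la * t := by rw [ht]; field_simp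
      have htpos : 0 < t := by rw [ht]; positivity
      rw [← ht]
      by_contra! hlt
      have e1 : (la + ρ) * ψ w₀ ≤ (la + ρ) * (ρ * m w₀ - t^2) :=
        mul_le_mul_of_nonneg_left hlt (by linarith)
      have e2 : ρ * (ρ * m w₀) ≤ ρ * t := by
        refine mul_le_mul_of_nonneg_left ?_ hρ.le
        rw [hρt]; nlinarith
      have e3 : la * t^2 = ρ * t := by rw [hρt]; ring
      have e4 : 0 < ρ * t^2 := by positivity
      linarith
  intro w hw
  refine ⟨hgap w (Ico_subset_Icc_self hw), ?_⟩
  rcases hw.1.eq_or_lt with rfl | h1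
  · rw [hψL, hmL, mul_one_div]; exact hψ_lt_left
  rcases le_or_gt w 0 with h0 | h0
  · exact strict_left w ⟨h1, h0⟩
  · exact strict_right w ⟨h0, hw.2⟩
end
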